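/- arXiv:math/9902138 — 6 statements merged into one kernel-verified Lean document; each statement's English description precedes it below -/
import Mathlib

section
/- Let V be a C¹ vector field on ℝ² and let C > 0 be a constant such that div V(x) ≥ C‖V(x)‖² for every x ∈ ℝ². Then V vanishes identically on ℝ². -/
open MeasureTheory Set

theorem hasDerivAt_max_zero_sq (s : ℝ) :
    HasDerivAt (fun t : ℝ ↦ max t 0 ^ 2) (2 * max s 0) s := by
  rcases lt_trichotomy s 0 with h | rfl | h
  · rw [max_eq_right h.le, mul_zero]
    refine (hasDerivAt_const s (0 : ℝ)).congr_of_eventuallyEq ?_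
    filter_upwards [eventually_lt_nhds h] with t ht
    simp [ht.le]
  · rw [hasDerivAt_iff_isLittleO]
    have h1 : (fun t : ℝ ↦ t ^ 2) =o[nhds 0] fun t : ℝ ↦ t := by
      simpa using Asymptotics.isLittleO_pow_id (𝕜 := ℝ) (n := 2) (by norm_num)
    refine Asymptotics.IsBigO.trans_isLittleO (Asymptotics.IsBigO.of_bound 1 ?_)
      (by simpa using h1)
    refine Filter.Eventually.of_forall fun t ↦ ?_
    rcases le_total t 0 with ht | ht <;> simp [ht]
    positivity
  · rw [max_eq_left h.le]
    have h1 : HasDerivAt (fun t : ℝ ↦ t ^ 2) (2 * s) s := by simpa using hasDerivAt_pow 2 s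
    refine h1.congr_of_eventuallyEq ?_
    filter_upwards [eventually_gt_nhds h] with t ht
    simp [ht.le]

theorem contDiff_max_zero_sq : ContDiff ℝ 1 fun t : ℝ ↦ max t 0 ^ 2 := by
  refine contDiff_one_iff_deriv.2 ⟨fun s ↦ (hasDerivAt_max_zero_sq s).differentiableAt, ?_⟩
  rw [funext fun s ↦ (hasDerivAt_max_zero_sq s).deriv]
  fun_prop

/-- The logarithmic cutoff at scale `N`, supported where `log (1 + |x|²) ≤ N`. -/
noncomputable def logCutoff (N : ℝ) (x : ℝ × ℝ) : ℝ :=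
  max (1 - Real.log (1 + (x.1 ^ 2 + x.2 ^ 2)) / N) 0

theorem hasFDerivAt_logCutoff_sq (N : ℝ) (x : ℝ × ℝ) :
    HasFDerivAt (fun y ↦ logCutoff N y ^ 2)
      ((-(4 * logCutoff N x / ((1 + (x.1 ^ 2 + x.2 ^ 2)) * N))) •
        (x.1 • ContinuousLinearMap.fst ℝ ℝ ℝ + x.2 • ContinuousLinearMap.snd ℝ ℝ ℝ)) x := by
  have hq : (1 + (x.1 ^ 2 + x.2 ^ 2)) ≠ 0 := by positivity
  have h1 : HasFDerivAt (fun y : ℝ × ℝ ↦ 1 + (y.1 ^ 2 + y.2 ^ 2))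
      ((2 * x.1) • ContinuousLinearMap.fst ℝ ℝ ℝ + (2 * x.2) • ContinuousLinearMap.snd ℝ ℝ ℝ) x := by
    have hfst : HasFDerivAt (fun y : ℝ × ℝ ↦ y.1) (ContinuousLinearMap.fst ℝ ℝ ℝ) x :=
      hasFDerivAt_fst
    have hsnd : HasFDerivAt (fun y : ℝ × ℝ ↦ y.2) (ContinuousLinearMap.snd ℝ ℝ ℝ) x :=
      hasFDerivAt_snd
    refine (((hfst.pow 2).add (hsnd.pow 2)).const_add 1).congr_fderiv ?_
    ext <;> simp
  have h2 : HasDerivAt (fun t : ℝ ↦ 1 - Real.log t / N)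
      (-((1 + (x.1 ^ 2 + x.2 ^ 2))⁻¹ / N)) (1 + (x.1 ^ 2 + x.2 ^ 2)) :=
    ((Real.hasDerivAt_log hq).div_const N).const_sub 1
  have h3 := (HasDerivAt.comp (1 + (x.1 ^ 2 + x.2 ^ 2))
    (h₂ := fun t : ℝ ↦ max t 0 ^ 2) (h := fun t : ℝ ↦ 1 - Real.log t / N)
    (hasDerivAt_max_zero_sq _) h2).comp_hasFDerivAt x h1
  refine HasFDerivAt.congr_fderiv (f := fun y ↦ logCutoff N y ^ 2) h3 ?_
  rw [← logCutoff]
  ext <;> simp <;> field_simp <;> ring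

theorem contDiff_logCutoff_sq (N : ℝ) : ContDiff ℝ 1 fun x ↦ logCutoff N x ^ 2 := by
  refine contDiff_max_zero_sq.comp (contDiff_const.sub (ContDiff.div_const ?_ N))
  refine ContDiff.log (by fun_prop) fun x ↦ by positivity

theorem norm_sq_le_add_sq (x : ℝ × ℝ) : ‖x‖ ^ 2 ≤ x.1 ^ 2 + x.2 ^ 2 := by
  rw [Prod.norm_def]
  rcases max_choice ‖x.1‖ ‖x.2‖ with h | h <;> rw [h, Real.norm_eq_abs, sq_abs] <;>
    nlinarith [sq_nonneg x.1, sq_nonneg x.2]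

theorem logCutoff_eq_zero {R : ℝ} (hR : 0 < R) {x : ℝ × ℝ} (hx : R < ‖x‖) :
    logCutoff (Real.log (1 + R ^ 2)) x = 0 := by
  refine max_eq_right (sub_nonpos.2 ((one_le_div (Real.log_pos (by nlinarith))).2 ?_))
  exact Real.log_le_log (by positivity) (by nlinarith [norm_sq_le_add_sq x])

theorem hasCompactSupport_logCutoff_sq {R : ℝ} (hR : 0 < R) :
    HasCompactSupport fun x ↦ logCutoff (Real.log (1 + R ^ 2)) x ^ 2 := by
  refine HasCompactSupport.intro (isCompact_closedBall (0 : ℝ × ℝ) R) fun x hx ↦ ?_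
  simp [logCutoff_eq_zero hR (by simpa using hx)]

theorem logCutoff_mono {N M : ℝ} (hN : 0 < N) (hNM : N ≤ M) (x : ℝ × ℝ) :
    logCutoff N x ≤ logCutoff M x := by
  refine max_le_max (sub_le_sub_left
    (div_le_div_of_nonneg_left (Real.log_nonneg ?_) hN hNM) 1) le_rfl
  nlinarith [sq_nonneg x.1, sq_nonneg x.2]

theorem integral_mul_div_add_fderiv_eq_zero {f : ℝ × ℝ → ℝ} {V : ℝ × ℝ → ℝ × ℝ}
    (hf : ContDiff ℝ 1 f) (hs : HasCompactSupport f) (hV : ContDiff ℝ 1 V) :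
    Integrable (fun x ↦ f x * ((fderiv ℝ V x (1, 0)).1 + (fderiv ℝ V x (0, 1)).2) +
      fderiv ℝ f x (V x)) ∧
    ∫ x, (f x * ((fderiv ℝ V x (1, 0)).1 + (fderiv ℝ V x (0, 1)).2) +
      fderiv ℝ f x (V x)) = 0 := by
  have parts (g : ℝ × ℝ → ℝ) (hg : ContDiff ℝ 1 g) (v : ℝ × ℝ) :
      Integrable (fun x ↦ f x * fderiv ℝ g x v) ∧ Integrable (fun x ↦ fderiv ℝ f x v * g x) ∧
      ∫ x, f x * fderiv ℝ g x v = - ∫ x, fderiv ℝ f x v * g x := by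
    have cf : Continuous fun x ↦ fderiv ℝ f x v :=
      (hf.continuous_fderiv one_ne_zero).clm_apply continuous_const
    have cg : Continuous fun x ↦ fderiv ℝ g x v :=
      (hg.continuous_fderiv one_ne_zero).clm_apply continuous_const
    have i1 : Integrable (fun x ↦ f x * fderiv ℝ g x v) :=
      (hf.continuous.mul cg).integrable_of_hasCompactSupport hs.mul_right
    have i2 : Integrable (fun x ↦ fderiv ℝ f x v * g x) :=
      (cf.mul hg.continuous).integrable_of_hasCompactSupport (hs.fderiv_apply ℝ v).mul_right
    have i3 : Integrable (fun x ↦ f x * g x) :=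
      (hf.continuous.mul hg.continuous).integrable_of_hasCompactSupport hs.mul_right
    exact ⟨i1, i2, integral_mul_fderiv_eq_neg_fderiv_mul_of_integrable i2 i1 i3
      (fun x _ ↦ hf.differentiable one_ne_zero x) (fun x _ ↦ hg.differentiable one_ne_zero x)⟩
  obtain ⟨a1, a2, a3⟩ := parts (fun x ↦ (V x).1) hV.fst (1, 0)
  obtain ⟨b1, b2, b3⟩ := parts (fun x ↦ (V x).2) hV.snd (0, 1)
  have key : (fun x ↦ f x * ((fderiv ℝ V x (1, 0)).1 + (fderiv ℝ V x (0, 1)).2) +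
      fderiv ℝ f x (V x)) = fun x ↦
      (f x * fderiv ℝ (fun x ↦ (V x).1) x (1, 0) + fderiv ℝ f x (1, 0) * (V x).1) +
      (f x * fderiv ℝ (fun x ↦ (V x).2) x (0, 1) + fderiv ℝ f x (0, 1) * (V x).2) := by
    funext x
    have hx := hV.differentiable one_ne_zero x
    have hv : V x = (V x).1 • ((1 : ℝ), (0 : ℝ)) + (V x).2 • ((0 : ℝ), (1 : ℝ)) := by
      ext <;> simp
    have hfv : fderiv ℝ f x (V x) =
        (V x).1 * fderiv ℝ f x (1, 0) + (V x).2 * fderiv ℝ f x (0, 1) := by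
      conv_lhs => rw [hv]
      rw [map_add, map_smul, map_smul, smul_eq_mul, smul_eq_mul]
    rw [hfv, fderiv.fst hx, fderiv.snd hx]
    simp only [ContinuousLinearMap.comp_apply, ContinuousLinearMap.coe_fst',
      ContinuousLinearMap.coe_snd']
    ring
  rw [key]
  refine ⟨(a1.add a2).add (b1.add b2), ?_⟩
  refine (integral_add (a1.add a2) (b1.add b2)).trans ?_
  simp only [Pi.add_apply]
  rw [integral_add a1 a2, integral_add b1 b2, a3, b3]
  ring

theorem integral_indicator_inv_one_add_norm_sq {R : ℝ} (hR : 0 < R) :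
    ∫ x : ℝ × ℝ, (Iic R).indicator (fun r ↦ (1 + r ^ 2)⁻¹) ‖x‖ =
      volume.real (Metric.ball (0 : ℝ × ℝ) 1) * Real.log (1 + R ^ 2) := by
  have h : ∫ r in Ioi (0 : ℝ), r * (Iic R).indicator (fun r ↦ (1 + r ^ 2)⁻¹) r =
      Real.log (1 + R ^ 2) / 2 := by
    have h1 : (fun r : ℝ ↦ r * (Iic R).indicator (fun r ↦ (1 + r ^ 2)⁻¹) r) =
        (Iic R).indicator (fun r ↦ r * (1 + r ^ 2)⁻¹) := by
      funext r
      by_cases hr : r ∈ Iic R <;> simp [hr]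
    rw [h1, setIntegral_indicator measurableSet_Iic, Ioi_inter_Iic,
      ← intervalIntegral.integral_of_le hR.le]
    rw [intervalIntegral.integral_eq_sub_of_hasDerivAt
      (f := fun r ↦ Real.log (1 + r ^ 2) / 2)]
    · simp
    · intro r _
      have := ((((hasDerivAt_pow 2 r).const_add 1).log (by positivity)).div_const 2)
      refine this.congr_deriv ?_
      simp
      ring
    · refine ContinuousOn.intervalIntegrable (Continuous.continuousOn ?_)
      exact continuous_id.mul (Continuous.inv₀ (by fun_prop) fun r ↦ by positivity)
  rw [integral_fun_norm_addHaar volume]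
  simp only [Module.finrank_prod, Module.finrank_self, smul_eq_mul, nsmul_eq_mul]
  norm_num [h]
  ring

theorem integrable_indicator_inv_one_add_norm_sq (R : ℝ) :
    Integrable fun x : ℝ × ℝ ↦ (Iic R).indicator (fun r ↦ (1 + r ^ 2)⁻¹) ‖x‖ := by
  have h : (fun x : ℝ × ℝ ↦ (Iic R).indicator (fun r ↦ (1 + r ^ 2)⁻¹) ‖x‖) =
      (Metric.closedBall (0 : ℝ × ℝ) R).indicator (fun x ↦ (1 + ‖x‖ ^ 2)⁻¹) := by
    funext x
    simp [indicator]
  rw [h, integrable_indicator_iff Metric.isClosed_closedBall.measurableSet]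
  refine ContinuousOn.integrableOn_compact (isCompact_closedBall _ _) (Continuous.continuousOn ?_)
  exact Continuous.inv₀ (by fun_prop) fun r ↦ by positivity

theorem logCutoff_sq_mul_le {V : ℝ × ℝ → ℝ × ℝ} {C : ℝ} (hC : 0 < C)
    (hdiv : ∀ x : ℝ × ℝ,
      (fderiv ℝ V x (1, 0)).1 + (fderiv ℝ V x (0, 1)).2 ≥
        C * ((V x).1 ^ 2 + (V x).2 ^ 2)) {R : ℝ} (hR : 0 < R) (x : ℝ × ℝ) :
    C / 2 * (logCutoff (Real.log (1 + R ^ 2)) x ^ 2 * ((V x).1 ^ 2 + (V x).2 ^ 2)) ≤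
      (logCutoff (Real.log (1 + R ^ 2)) x ^ 2 *
        ((fderiv ℝ V x (1, 0)).1 + (fderiv ℝ V x (0, 1)).2) +
        fderiv ℝ (fun y ↦ logCutoff (Real.log (1 + R ^ 2)) y ^ 2) x (V x)) +
      8 / (C * Real.log (1 + R ^ 2) ^ 2) * (Iic R).indicator (fun r ↦ (1 + r ^ 2)⁻¹) ‖x‖ := by
  have hN : 0 < Real.log (1 + R ^ 2) := Real.log_pos (by nlinarith)
  rw [(hasFDerivAt_logCutoff_sq _ x).fderiv]
  rcases lt_or_ge R ‖x‖ with hx | hx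
  · simp [logCutoff_eq_zero hR hx, hx]
  rw [indicator_of_mem (mem_Iic.2 hx)]
  set N := Real.log (1 + R ^ 2)
  set u := logCutoff N x
  set q := x.1 ^ 2 + x.2 ^ 2 with hq
  have hq0 : 0 ≤ q := by positivity
  have h1 := mul_le_mul_of_nonneg_left (hdiv x) (sq_nonneg u)
  have h2 : q / ((1 + q) * N) ^ 2 ≤ (1 + ‖x‖ ^ 2)⁻¹ / N ^ 2 := by
    rw [mul_pow, ← div_div]
    gcongr
    have h3 := norm_sq_le_add_sq x
    calc q / (1 + q) ^ 2 ≤ (1 + q)⁻¹ := by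
          rw [div_le_iff₀ (by positivity)]
          field_simp
          linarith
      _ ≤ _ := by gcongr
  have h3 := mul_le_mul_of_nonneg_left h2 (show 0 ≤ 8 / C by positivity)
  have h4 : 0 ≤ C / 2 * ((u * (V x).1 - 4 / C * (x.1 / ((1 + q) * N))) ^ 2 +
      (u * (V x).2 - 4 / C * (x.2 / ((1 + q) * N))) ^ 2) := by positivity
  have h5 : C / 2 * ((u * (V x).1 - 4 / C * (x.1 / ((1 + q) * N))) ^ 2 +
      (u * (V x).2 - 4 / C * (x.2 / ((1 + q) * N))) ^ 2) =
      C / 2 * (u ^ 2 * ((V x).1 ^ 2 + (V x).2 ^ 2)) -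
      4 * u / ((1 + q) * N) * (x.1 * (V x).1 + x.2 * (V x).2) +
      8 / C * (q / ((1 + q) * N) ^ 2) := by
    rw [show q / ((1 + q) * N) ^ 2 = (x.1 ^ 2 + x.2 ^ 2) / ((1 + q) * N) ^ 2 by rw [hq]]
    field_simp
    ring
  have h6 : 8 / (C * N ^ 2) * (1 + ‖x‖ ^ 2)⁻¹ = 8 / C * ((1 + ‖x‖ ^ 2)⁻¹ / N ^ 2) := by
    field_simp
  rw [h6]
  simp only [smul_apply, add_apply,
    ContinuousLinearMap.coe_fst', ContinuousLinearMap.coe_snd', smul_eq_mul]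
  linarith

theorem integral_logCutoff_sq_mul_le {V : ℝ × ℝ → ℝ × ℝ} {C : ℝ} (hC : 0 < C)
    (hV : ContDiff ℝ 1 V)
    (hdiv : ∀ x : ℝ × ℝ,
      (fderiv ℝ V x (1, 0)).1 + (fderiv ℝ V x (0, 1)).2 ≥
        C * ((V x).1 ^ 2 + (V x).2 ^ 2)) {R : ℝ} (hR : 0 < R) :
    Integrable (fun x ↦ logCutoff (Real.log (1 + R ^ 2)) x ^ 2 *
      ((V x).1 ^ 2 + (V x).2 ^ 2)) ∧
    ∫ x, logCutoff (Real.log (1 + R ^ 2)) x ^ 2 * ((V x).1 ^ 2 + (V x).2 ^ 2) ≤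
      16 * volume.real (Metric.ball (0 : ℝ × ℝ) 1) / C ^ 2 / Real.log (1 + R ^ 2) := by
  have hN : 0 < Real.log (1 + R ^ 2) := Real.log_pos (by nlinarith)
  have hs := hasCompactSupport_logCutoff_sq hR
  have hf := contDiff_logCutoff_sq (Real.log (1 + R ^ 2))
  have hVc := hV.continuous
  obtain ⟨i1, e1⟩ := integral_mul_div_add_fderiv_eq_zero hf hs hV
  have i2 := (integrable_indicator_inv_one_add_norm_sq R).const_mul
    (8 / (C * Real.log (1 + R ^ 2) ^ 2))
  have i0 : Integrable (fun x ↦ logCutoff (Real.log (1 + R ^ 2)) x ^ 2 *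
      ((V x).1 ^ 2 + (V x).2 ^ 2)) :=
    (hf.continuous.mul (by fun_prop)).integrable_of_hasCompactSupport hs.mul_right
  refine ⟨i0, ?_⟩
  have h := integral_mono (i0.const_mul (C / 2)) (i1.add i2) (logCutoff_sq_mul_le hC hdiv hR)
  simp only [Pi.add_apply] at h
  rw [integral_add i1 i2, e1, integral_const_mul, integral_const_mul,
    integral_indicator_inv_one_add_norm_sq hR, zero_add] at h
  refine le_of_mul_le_mul_left (h.trans_eq ?_) (half_pos hC)
  field_simp
  ring

/-- Let `V` be a `C¹` vector field on `ℝ²` and `C > 0` a constant such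
that `div V x ≥ C‖V x‖²` for every `x ∈ ℝ²`.  Here `div V = ∂V₁/∂x₁ + ∂V₂/∂x₂` and
`‖V‖² = V₁² + V₂²`.  Then `V` vanishes identically. -/
theorem shock_lemma_divergence_vector_field_vanishes
    (V : ℝ × ℝ → ℝ × ℝ) (C : ℝ) (hC : 0 < C)
    (hV : ContDiff ℝ 1 V)
    (hdiv : ∀ x : ℝ × ℝ,
      (fderiv ℝ V x (1, 0)).1 + (fderiv ℝ V x (0, 1)).2 ≥
        C * ((V x).1 ^ 2 + (V x).2 ^ 2)) :
    ∀ x : ℝ × ℝ, V x = 0 := by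
  intro x₀
  by_contra hx₀
  have hpos : 0 < (V x₀).1 ^ 2 + (V x₀).2 ^ 2 := by
    by_contra! h
    refine hx₀ (Prod.ext ?_ ?_) <;>
      exact pow_eq_zero_iff two_ne_zero |>.1
        (le_antisymm (by nlinarith [sq_nonneg (V x₀).1, sq_nonneg (V x₀).2]) (sq_nonneg _))
  have htop : Filter.Tendsto (fun R : ℝ ↦ Real.log (1 + R ^ 2)) Filter.atTop Filter.atTop :=
    Real.tendsto_log_atTop.comp
      (Filter.tendsto_atTop_add_const_left _ 1 (Filter.tendsto_pow_atTop two_ne_zero))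
  obtain ⟨R₀, hR₀, hR₀x⟩ := ((Filter.eventually_gt_atTop (0 : ℝ)).and
    (htop.eventually_gt_atTop (Real.log (1 + (x₀.1 ^ 2 + x₀.2 ^ 2))))).exists
  have hN₀ : 0 < Real.log (1 + R₀ ^ 2) := Real.log_pos (by nlinarith)
  have hu : 0 < logCutoff (Real.log (1 + R₀ ^ 2)) x₀ :=
    lt_max_of_lt_left (sub_pos.2 ((div_lt_one hN₀).2 hR₀x))
  have hVc := hV.continuous
  have hI : 0 < ∫ x, logCutoff (Real.log (1 + R₀ ^ 2)) x ^ 2 * ((V x).1 ^ 2 + (V x).2 ^ 2) :=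
    Continuous.integral_pos_of_hasCompactSupport_nonneg_nonzero (x := x₀)
      ((contDiff_logCutoff_sq _).continuous.mul (by fun_prop))
      (hasCompactSupport_logCutoff_sq hR₀).mul_right
      (fun x ↦ by positivity) (by positivity)
  obtain ⟨R, hR, hRR, hlt⟩ := ((Filter.eventually_gt_atTop (0 : ℝ)).and
    ((htop.eventually_ge_atTop (Real.log (1 + R₀ ^ 2))).and
      ((htop.const_div_atTop
        (16 * volume.real (Metric.ball (0 : ℝ × ℝ) 1) / C ^ 2)).eventually_lt_const hI))).exists
  obtain ⟨i₀, -⟩ := integral_logCutoff_sq_mul_le hC hV hdiv hR₀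
  obtain ⟨i, hle⟩ := integral_logCutoff_sq_mul_le hC hV hdiv hR
  refine (((integral_mono i₀ i fun x ↦ ?_).trans hle).trans_lt hlt).false
  have := logCutoff_mono hN₀ hRR x
  have h0 : 0 ≤ logCutoff (Real.log (1 + R₀ ^ 2)) x := le_max_right _ _
  dsimp only
  gcongr
end

section
/- Let C > 0 and let φ : (0, ∞) → ℝ be a differentiable function satisfying φ'(r) ≥ (C/(2πr))·φ(r)² for all r > 0. Then φ(r) = 0 for all r > 0. -/
/-- A global solution on `ℝ` of the Riccati inequality `ψ' ≥ k ψ²` is nowhere positive: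
a positive value forces blow-up in finite forward time. -/
theorem nonpos_of_riccati_inequality {k : ℝ} (hk : 0 < k) {ψ ψ' : ℝ → ℝ}
    (hψ : ∀ t, HasDerivAt ψ (ψ' t) t) (h : ∀ t, k * ψ t ^ 2 ≤ ψ' t) (a : ℝ) : ψ a ≤ 0 := by
  by_contra! ha
  have hmono : Monotone ψ :=
    monotone_of_hasDerivAt_nonneg hψ fun t => (by positivity : 0 ≤ k * ψ t ^ 2).trans (h t)
  have hpos : ∀ t ∈ Set.Ici a, 0 < ψ t := fun t ht => ha.trans_le (hmono ht)
  have hd : ∀ t ∈ Set.Ici a,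
      HasDerivAt (fun t => (ψ t)⁻¹ + k * t) (-ψ' t / ψ t ^ 2 + k * 1) t := fun t ht =>
    ((hψ t).fun_inv (hpos t ht).ne').fun_add ((hasDerivAt_id t).const_mul k)
  have hanti : AntitoneOn (fun t => (ψ t)⁻¹ + k * t) (Set.Ici a) := by
    refine antitoneOn_of_deriv_nonpos (convex_Ici a)
      (fun t ht => (hd t ht).continuousAt.continuousWithinAt)
      (fun t ht => (hd t (interior_subset ht)).differentiableAt.differentiableWithinAt)
      fun t ht => ?_
    have ht' := interior_subset ht
    have hle : k ≤ ψ' t / ψ t ^ 2 := (le_div_iff₀ (pow_pos (hpos t ht') 2)).2 (h t)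
    rw [(hd t ht').deriv, neg_div]
    linarith
  have hab : a ≤ a + (ψ a)⁻¹ / k := le_add_of_nonneg_right (by positivity)
  have hle := hanti Set.self_mem_Ici hab hab
  have hb := inv_pos.2 (hpos _ hab)
  simp only [mul_add, mul_div_cancel₀ _ hk.ne'] at hle
  linarith

/-- The only global solution on `ℝ` of the Riccati inequality `ψ' ≥ k ψ²` is zero. -/
theorem eq_zero_of_riccati_inequality {k : ℝ} (hk : 0 < k) {ψ ψ' : ℝ → ℝ}
    (hψ : ∀ t, HasDerivAt ψ (ψ' t) t) (h : ∀ t, k * ψ t ^ 2 ≤ ψ' t) (a : ℝ) : ψ a = 0 := by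
  refine le_antisymm (nonpos_of_riccati_inequality hk hψ h a) ?_
  have hneg := nonpos_of_riccati_inequality hk (ψ := fun t => -ψ (-t)) (ψ' := fun t => ψ' (-t))
    (fun t => ((hψ (-t)).comp t (hasDerivAt_neg t)).neg.congr_deriv (by simp))
    (fun t => by simpa using h (-t)) (-a)
  simpa using hneg

/-- Let `C > 0` and let `φ : (0,∞) → ℝ` be differentiable with
`φ'(r) ≥ (C/(2πr))·φ(r)²` for all `r > 0`.  Then `φ(r) = 0` for all `r > 0`. -/
theorem flux_differential_inequality_forces_vanishing
    (C : ℝ) (hC : 0 < C) (φ φ' : ℝ → ℝ)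
    (hderiv : ∀ r > (0 : ℝ), HasDerivAt φ (φ' r) r)
    (hineq : ∀ r > (0 : ℝ), φ' r ≥ C / (2 * Real.pi * r) * (φ r) ^ 2) :
    ∀ r > (0 : ℝ), φ r = 0 := by
  intro r hr
  have hzero := eq_zero_of_riccati_inequality (k := C / (2 * Real.pi)) (by positivity)
    (ψ := fun t => φ (Real.exp t)) (ψ' := fun t => φ' (Real.exp t) * Real.exp t)
    (fun t => (hderiv _ (Real.exp_pos t)).comp t (Real.hasDerivAt_exp t))
    (fun t => by
      calc C / (2 * Real.pi) * φ (Real.exp t) ^ 2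
          = C / (2 * Real.pi * Real.exp t) * φ (Real.exp t) ^ 2 * Real.exp t := by
            field_simp
        _ ≤ φ' (Real.exp t) * Real.exp t :=
            mul_le_mul_of_nonneg_right (hineq _ (Real.exp_pos t)) (Real.exp_pos t).le)
    (Real.log r)
  simpa only [Real.exp_log hr] using hzero
end

section
/- Let V be a C¹ vector field on ℝ² and C > 0 a constant with div V(x) ≥ C‖V(x)‖² for all x ∈ ℝ². Define the flux φ(r) = ∫₀^{2π} ⟨V(r cos θ, r sin θ), (cos θ, sin θ)⟩ · r dθ for r > 0. Then φ is differentiable and φ'(r) ≥ (C/(2πr))·φ(r)² for all r > 0. -/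
open Real

/-- Differentiation under the integral sign for a jointly continuous derivative. -/
theorem hasDerivAt_intervalIntegral_of_continuous_deriv {F F' : ℝ → ℝ → ℝ} (a b r : ℝ)
    (hF : ∀ x, Continuous (F x)) (hF' : Continuous fun p : ℝ × ℝ => F' p.1 p.2)
    (hd : ∀ x t, HasDerivAt (fun x => F x t) (F' x t) x) :
    HasDerivAt (fun x => ∫ t in a..b, F x t) (∫ t in a..b, F' r t) r := by
  obtain ⟨K, hK⟩ := ((isCompact_closedBall r 1).prod
    (isCompact_uIcc (a := a) (b := b))).exists_bound_of_continuousOn hF'.continuousOn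
  have hF'r : Continuous (F' r) := hF'.comp (by fun_prop : Continuous fun t : ℝ => (r, t))
  refine (intervalIntegral.hasDerivAt_integral_of_dominated_loc_of_deriv_le
    (bound := fun _ => K) (Metric.ball_mem_nhds r one_pos) ?_ ?_ ?_ ?_ ?_ ?_).2
  · exact .of_forall fun x => (hF x).aestronglyMeasurable
  · exact (hF r).intervalIntegrable a b
  · exact hF'r.aestronglyMeasurable
  · exact .of_forall fun t ht x hx =>
      hK (x, t) ⟨Metric.ball_subset_closedBall hx, Set.uIoc_subset_uIcc ht⟩
  · exact continuous_const.intervalIntegrable a b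
  · exact .of_forall fun t _ x _ => hd x t

/-- The derivatives of the components of a field along a curve, in terms of its partial
derivatives. -/
theorem hasDerivAt_comp_curve {V : ℝ × ℝ → ℝ × ℝ} (hV : Differentiable ℝ V) {x y : ℝ → ℝ}
    {x' y' t : ℝ} (hx : HasDerivAt x x' t) (hy : HasDerivAt y y' t) :
    HasDerivAt (fun t => (V (x t, y t)).1)
      (x' * (fderiv ℝ V (x t, y t) (1, 0)).1 + y' * (fderiv ℝ V (x t, y t) (0, 1)).1) t ∧
    HasDerivAt (fun t => (V (x t, y t)).2)
      (x' * (fderiv ℝ V (x t, y t) (1, 0)).2 + y' * (fderiv ℝ V (x t, y t) (0, 1)).2) t := by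
  have h := (hV (x t, y t)).hasFDerivAt.comp_hasDerivAt t (hx.prodMk hy)
  have e : ((x', y') : ℝ × ℝ) = x' • (1, 0) + y' • (0, 1) := by simp
  rw [e, map_add, map_smul, map_smul] at h
  exact ⟨h.hasFDerivAt.fst.hasDerivAt.congr_deriv (by simp),
    h.hasFDerivAt.snd.hasDerivAt.congr_deriv (by simp)⟩

/-- The flux through a circle has derivative `∫ r * div V`. -/
theorem hasDerivAt_circle_flux {V : ℝ × ℝ → ℝ × ℝ} (hV : ContDiff ℝ 1 V) (r : ℝ) :
    HasDerivAt (fun r : ℝ => ∫ θ in (0:ℝ)..(2 * π),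
        ((V (r * cos θ, r * sin θ)).1 * cos θ + (V (r * cos θ, r * sin θ)).2 * sin θ) * r)
      (∫ θ in (0:ℝ)..(2 * π), r * ((fderiv ℝ V (r * cos θ, r * sin θ) (1, 0)).1 +
        (fderiv ℝ V (r * cos θ, r * sin θ) (0, 1)).2)) r := by
  have hVd : Differentiable ℝ V := hV.differentiable one_ne_zero
  have hVc : Continuous V := hV.continuous
  have hA : Continuous fun x => fderiv ℝ V x (1, 0) :=
    (hV.continuous_fderiv one_ne_zero).clm_apply continuous_const
  have hB : Continuous fun x => fderiv ℝ V x (0, 1) :=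
    (hV.continuous_fderiv one_ne_zero).clm_apply continuous_const
  generalize hAe : (fun x => fderiv ℝ V x (1, 0)) = A at hA
  generalize hBe : (fun x => fderiv ℝ V x (0, 1)) = B at hB
  have hAx : ∀ x, fderiv ℝ V x (1, 0) = A x := fun x => congrFun hAe x
  have hBx : ∀ x, fderiv ℝ V x (0, 1) = B x := fun x => congrFun hBe x
  have curve {x y : ℝ → ℝ} {x' y' t : ℝ} (hx : HasDerivAt x x' t) (hy : HasDerivAt y y' t) :=
    hasDerivAt_comp_curve hVd hx hy
  simp only [hAx, hBx] at curve ⊢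
  let F' : ℝ → ℝ → ℝ := fun r θ =>
    ((cos θ * (A (r * cos θ, r * sin θ)).1 + sin θ * (B (r * cos θ, r * sin θ)).1) * cos θ +
      (cos θ * (A (r * cos θ, r * sin θ)).2 + sin θ * (B (r * cos θ, r * sin θ)).2) * sin θ) * r +
    ((V (r * cos θ, r * sin θ)).1 * cos θ + (V (r * cos θ, r * sin θ)).2 * sin θ)
  let G : ℝ → ℝ := fun θ =>
    (V (r * cos θ, r * sin θ)).2 * cos θ - (V (r * cos θ, r * sin θ)).1 * sin θ
  let D : ℝ → ℝ := fun θ => r * ((A (r * cos θ, r * sin θ)).1 + (B (r * cos θ, r * sin θ)).2)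
  have hF'c : Continuous fun p : ℝ × ℝ => F' p.1 p.2 := by fun_prop
  have hF'r : Continuous (F' r) := by fun_prop
  have hDc : Continuous D := by fun_prop
  have hG : ∀ θ, HasDerivAt G (D θ - F' r θ) θ := by
    intro θ
    obtain ⟨h₁, h₂⟩ := curve ((hasDerivAt_cos θ).const_mul r) ((hasDerivAt_sin θ).const_mul r)
    refine ((h₂.mul (hasDerivAt_cos θ)).sub (h₁.mul (hasDerivAt_sin θ))).congr_deriv ?_
    simp only [D, F']
    linear_combination (-r * ((A (r * cos θ, r * sin θ)).1 + (B (r * cos θ, r * sin θ)).2)) *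
      (sin_sq_add_cos_sq θ).symm
  have hint : ∫ θ in (0:ℝ)..(2 * π), (D θ - F' r θ) = 0 := by
    rw [intervalIntegral.integral_eq_sub_of_hasDerivAt (fun θ _ => hG θ)
      ((hDc.sub hF'r).intervalIntegrable _ _)]
    simp [G]
  rw [intervalIntegral.integral_sub (hDc.intervalIntegrable _ _) (hF'r.intervalIntegrable _ _),
    sub_eq_zero] at hint
  change HasDerivAt _ (∫ θ in (0:ℝ)..(2 * π), D θ) r
  rw [hint]
  refine hasDerivAt_intervalIntegral_of_continuous_deriv 0 (2 * π) r (fun x => by fun_prop) hF'c ?_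
  intro x θ
  obtain ⟨h₁, h₂⟩ := curve ((hasDerivAt_id x).mul_const (cos θ)) ((hasDerivAt_id x).mul_const (sin θ))
  refine (((h₁.mul_const (cos θ)).add (h₂.mul_const (sin θ))).mul
    (hasDerivAt_id x)).congr_deriv ?_
  simp [F']

/-- Let `V` be a `C¹` vector field on `ℝ²` with `div V ≥ C‖V‖²`
(`C > 0`), and let `φ(r)` be the outward flux of `V` through the circle of radius `r`.
Then `φ` is differentiable on `(0,∞)` and `φ'(r) ≥ (C/(2πr))·φ(r)²` for all `r > 0`. -/
theorem flux_of_divergence_dominated_field_satisfies_riccati_inequality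
    (V : ℝ × ℝ → ℝ × ℝ) (C : ℝ) (hC : 0 < C) (hV : ContDiff ℝ 1 V)
    (hdiv : ∀ x : ℝ × ℝ,
      (fderiv ℝ V x (1, 0)).1 + (fderiv ℝ V x (0, 1)).2 ≥
        C * ((V x).1 ^ 2 + (V x).2 ^ 2))
    (φ : ℝ → ℝ)
    (hφ : ∀ r : ℝ, φ r =
      ∫ θ in (0:ℝ)..(2 * π),
        ((V (r * cos θ, r * sin θ)).1 * cos θ +
          (V (r * cos θ, r * sin θ)).2 * sin θ) * r) :
    ∀ r > (0 : ℝ), DifferentiableAt ℝ φ r ∧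
      deriv φ r ≥ C / (2 * π * r) * (φ r) ^ 2 := by
  intro r hr
  have hd := hasDerivAt_circle_flux hV r
  rw [← funext hφ] at hd
  refine ⟨hd.differentiableAt, ?_⟩
  rw [hd.deriv]
  have hVc : Continuous V := hV.continuous
  have hA : Continuous fun x => fderiv ℝ V x (1, 0) :=
    (hV.continuous_fderiv one_ne_zero).clm_apply continuous_const
  have hB : Continuous fun x => fderiv ℝ V x (0, 1) :=
    (hV.continuous_fderiv one_ne_zero).clm_apply continuous_const
  have hp : Continuous fun θ : ℝ => (r * cos θ, r * sin θ) := by fun_prop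
  have hDc : Continuous fun θ => r * ((fderiv ℝ V (r * cos θ, r * sin θ) (1, 0)).1 +
      (fderiv ℝ V (r * cos θ, r * sin θ) (0, 1)).2) :=
    continuous_const.mul ((hA.comp hp).fst.add (hB.comp hp).snd)
  let f : ℝ → ℝ := fun θ =>
    ((V (r * cos θ, r * sin θ)).1 * cos θ + (V (r * cos θ, r * sin θ)).2 * sin θ) * r
  have hfc : Continuous f := by fun_prop
  -- the mean of the normal component of `V` over the circle
  let m : ℝ := φ r / (2 * π * r)
  have hle : ∀ θ, 2 * C * m * f θ - C * r * m ^ 2 ≤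
      r * ((fderiv ℝ V (r * cos θ, r * sin θ) (1, 0)).1 +
        (fderiv ℝ V (r * cos θ, r * sin θ) (0, 1)).2) := by
    intro θ
    refine le_trans ?_ (mul_le_mul_of_nonneg_left (hdiv (r * cos θ, r * sin θ)) hr.le)
    simp only [f]
    generalize (V (r * cos θ, r * sin θ)).1 = p
    generalize (V (r * cos θ, r * sin θ)).2 = q
    have hsq : (p * cos θ + q * sin θ - m) ^ 2 + (p * sin θ - q * cos θ) ^ 2 =
        p ^ 2 + q ^ 2 - 2 * m * (p * cos θ + q * sin θ) + m ^ 2 := by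
      linear_combination (p ^ 2 + q ^ 2) * sin_sq_add_cos_sq θ
    have hnn : 0 ≤ C * r * (p ^ 2 + q ^ 2 - 2 * m * (p * cos θ + q * sin θ) + m ^ 2) := by
      rw [← hsq]; positivity
    linarith
  have hmono := intervalIntegral.integral_mono_on (μ := MeasureTheory.volume)
    (a := 0) (b := 2 * π) (by positivity)
    (((hfc.const_mul (2 * C * m)).sub continuous_const).intervalIntegrable _ _)
    (hDc.intervalIntegrable _ _) fun θ _ => hle θ
  simp only [Pi.sub_apply] at hmono
  rw [intervalIntegral.integral_sub ((hfc.const_mul _).intervalIntegrable _ _)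
    (continuous_const.intervalIntegrable _ _), intervalIntegral.integral_const_mul,
    intervalIntegral.integral_const, show ∫ θ in (0:ℝ)..(2 * π), f θ = φ r from (hφ r).symm] at hmono
  refine le_trans (le_of_eq ?_) hmono
  simp only [m, smul_eq_mul]
  field_simp
  ring
end

section
/- Let u : ℝ × ℝ → ℝ, (q,t) ↦ u(q,t), be a C² function with u(q+1, t) = u(q, t) for all (q,t), and suppose there is a constant K > 0 such that ∫₀¹ u_q(q,t)² dq < K for all t. Let ω : ℝ³ → ℝ, (p,q,t) ↦ ω(p,q,t), be a C¹ function, 1-periodic in q, satisfying the Riccati-type equation ω_t + p·ω_q − u_q·ω_p + ω² + u_qq = 0 everywhere. Then ω ≡ 0 and u_q ≡ 0. -/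
open MeasureTheory Set Filter Topology

theorem hasCompactSupport_mul_prod {f g : ℝ → ℝ} (hf : HasCompactSupport f)
    (hg : HasCompactSupport g) : HasCompactSupport (fun x : ℝ × ℝ => f x.1 * g x.2) := by
  refine HasCompactSupport.intro (IsCompact.prod hf hg) fun x hx => ?_
  by_cases h : x.1 ∈ tsupport f
  · have h2 : x.2 ∉ tsupport g := fun h2 => hx ⟨h, h2⟩
    simp [image_eq_zero_of_notMem_tsupport h2]
  · simp [image_eq_zero_of_notMem_tsupport h]

/-- The integral over the plane of `∂(f ⊗ f · W)/∂y` vanishes for compactly supported `f`. -/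
theorem integral_deriv_snd_mul_eq_zero {f : ℝ → ℝ} {W W' : ℝ × ℝ → ℝ}
    (hf : ContDiff ℝ 1 f) (hfc : HasCompactSupport f) (hW : Continuous W) (hW' : Continuous W')
    (hd : ∀ x y, HasDerivAt (fun y' => W (x, y')) (W' (x, y)) y) :
    ∫ x : ℝ × ℝ, (f x.1 * deriv f x.2 * W x + f x.1 * f x.2 * W' x) = 0 := by
  have hf0 := hf.continuous
  have hf1 := hf.continuous_deriv_one
  have hi : Integrable (fun x : ℝ × ℝ =>
      f x.1 * deriv f x.2 * W x + f x.1 * f x.2 * W' x) :=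
    Continuous.integrable_of_hasCompactSupport (by fun_prop)
      (((hasCompactSupport_mul_prod hfc hfc.deriv).mul_right).add
        ((hasCompactSupport_mul_prod hfc hfc).mul_right))
  rw [Measure.volume_eq_prod, integral_prod _ hi]
  refine integral_eq_zero_of_ae (.of_forall fun x => ?_)
  have hWx : Continuous fun y => W (x, y) := by fun_prop
  have hWx' : Continuous fun y => W' (x, y) := by fun_prop
  refine integral_eq_zero_of_hasDerivAt_of_integrable
    (f := fun y => f x * f y * W (x, y)) (fun y => ?_) ?_ ?_
  · exact (((hf.differentiable one_ne_zero y).hasDerivAt.const_mul (f x)).mul (hd x y))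
  · exact Continuous.integrable_of_hasCompactSupport (by fun_prop)
      ((hfc.deriv.mul_left.mul_right).add (hfc.mul_left.mul_right))
  · exact Continuous.integrable_of_hasCompactSupport (by fun_prop) (hfc.mul_left.mul_right)

/-- The integral over the plane of `∂(f ⊗ f · W)/∂x` vanishes for compactly supported `f`. -/
theorem integral_deriv_fst_mul_eq_zero {f : ℝ → ℝ} {W W' : ℝ × ℝ → ℝ}
    (hf : ContDiff ℝ 1 f) (hfc : HasCompactSupport f) (hW : Continuous W) (hW' : Continuous W')
    (hd : ∀ x y, HasDerivAt (fun x' => W (x', y)) (W' (x, y)) x) :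
    ∫ x : ℝ × ℝ, (deriv f x.1 * f x.2 * W x + f x.1 * f x.2 * W' x) = 0 := by
  have h := integral_deriv_snd_mul_eq_zero hf hfc (W := fun x => W x.swap)
    (W' := fun x => W' x.swap) (by fun_prop) (by fun_prop) (fun x y => hd y x)
  rw [Measure.volume_eq_prod, ← integral_prod_swap, ← Measure.volume_eq_prod, ← h]
  refine integral_congr_ae (.of_forall fun x => ?_)
  simp only [Prod.fst_swap, Prod.snd_swap]
  ring

/-- Fubini for a continuous function compactly supported in the first variable. -/
theorem integral_intervalIntegral_swap_of_compact {F : ℝ × ℝ → ℝ → ℝ} {S : Set (ℝ × ℝ)}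
    (hF : Continuous (Function.uncurry F)) (hS : IsCompact S) (hFS : ∀ x ∉ S, ∀ q, F x q = 0)
    (a b : ℝ) :
    ∫ x, ∫ q in a..b, F x q = ∫ q in a..b, ∫ x, F x q := by
  have h1 : IntegrableOn (Function.uncurry F) (S ×ˢ uIcc a b) :=
    hF.continuousOn.integrableOn_compact (hS.prod isCompact_uIcc)
  have h2 : IntegrableOn (Function.uncurry F) (univ ×ˢ uIoc a b) := by
    refine h1.of_forall_sdiff_eq_zero (MeasurableSet.univ.prod measurableSet_uIoc) ?_
    rintro ⟨x, q⟩ ⟨⟨-, hq⟩, hx⟩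
    exact hFS x (fun hxS => hx ⟨hxS, uIoc_subset_uIcc hq⟩) q
  refine (intervalIntegral_integral_swap ?_).symm
  rw [IntegrableOn, Measure.volume_eq_prod, ← Measure.prod_restrict, Measure.restrict_univ] at h2
  exact h2.swap

/-- For every scale there is a cutoff, equal to `1` on `[-R, R]` and to `0` off `[-2R, 2R]`, whose
slope is `O(1/R)` uniformly in the scale. -/
theorem exists_cutoff : ∃ M : ℝ, ∀ R : ℝ, 0 < R → ∃ φ : ℝ → ℝ, ContDiff ℝ 1 φ ∧
    HasCompactSupport φ ∧ (∀ s, 0 ≤ φ s) ∧ (∀ s, φ s ≤ 1) ∧ (∀ s, |s| ≤ R → φ s = 1) ∧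
    (∀ s, 2 * R < |s| → φ s = 0) ∧ (∀ s, |s| ≤ R → deriv φ s = 0) ∧
    (∀ s, |deriv φ s| ≤ M / R) := by
  let φ : ContDiffBump (0 : ℝ) := ⟨3 / 2, 2, by norm_num, by norm_num⟩
  have hφ : ContDiff ℝ 1 φ := φ.contDiff
  obtain ⟨M, hM⟩ := φ.hasCompactSupport.deriv.exists_bound_of_continuous hφ.continuous_deriv_one
  refine ⟨M, fun R hR => ⟨fun s => φ (s / R), by fun_prop, ?_, fun s => φ.nonneg,
    fun s => φ.le_one, fun s hs => ?_, fun s hs => ?_, ?_⟩⟩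
  · refine HasCompactSupport.intro (K := Icc (-(2 * R)) (2 * R)) isCompact_Icc fun s hs => ?_
    apply φ.zero_of_le_dist
    rw [mem_Icc, ← abs_le, not_le] at hs
    rw [Real.dist_eq, sub_zero, abs_div, abs_of_pos hR, le_div_iff₀ hR]
    exact hs.le
  · apply φ.one_of_mem_closedBall
    rw [Metric.mem_closedBall, Real.dist_eq, sub_zero, abs_div, abs_of_pos hR, div_le_iff₀ hR]
    change _ ≤ 3 / 2 * R
    linarith
  · apply φ.zero_of_le_dist
    rw [Real.dist_eq, sub_zero, abs_div, abs_of_pos hR, le_div_iff₀ hR]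
    exact hs.le
  have hd : ∀ s, deriv (fun s => φ (s / R)) s = deriv φ (s / R) / R := fun s => by
    have h := (hφ.differentiable one_ne_zero (s / R)).hasDerivAt.comp s
      ((hasDerivAt_id s).div_const R)
    rw [mul_one_div] at h
    exact h.deriv
  refine ⟨fun s hs => ?_, fun s => ?_⟩
  · have h : φ =ᶠ[𝓝 (s / R)] 1 := by
      apply φ.eventuallyEq_one_of_mem_ball
      rw [Metric.mem_ball, Real.dist_eq, sub_zero, abs_div, abs_of_pos hR, div_lt_iff₀ hR]
      change _ < 3 / 2 * R
      linarith
    rw [hd, h.deriv_eq]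
    simp
  · rw [hd, abs_div, abs_of_pos hR]
    gcongr
    exact hM _

theorem volume_real_closedBall_prod {R : ℝ} (hR : 0 ≤ R) :
    volume.real (Metric.closedBall (0 : ℝ × ℝ) R) = 4 * R ^ 2 := by
  rw [show (0 : ℝ × ℝ) = (0, 0) from rfl, ← closedBall_prod_same, Measure.volume_eq_prod,
    measureReal_prod_prod, measureReal_def, Real.volume_closedBall,
    ENNReal.toReal_ofReal (by positivity)]
  ring

theorem mem_closedBall_zero_prod {x : ℝ × ℝ} {R : ℝ} :
    x ∈ Metric.closedBall (0 : ℝ × ℝ) R ↔ |x.1| ≤ R ∧ |x.2| ≤ R := by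
  rw [mem_closedBall_zero_iff, Prod.norm_def, max_le_iff, Real.norm_eq_abs, Real.norm_eq_abs]

/-- A continuous vector field `(-b, a)` on the plane whose weak divergence `-c` controls its squared
length has zero divergence. The hypotheses `hac` and `hbc` say that `a ^ 2` and `b ^ 2`
are at most `4 * K * c`. -/
theorem eq_zero_of_sq_le_weak_divergence {a b c : ℝ × ℝ → ℝ} {K : ℝ} (hK : 0 ≤ K)
    (ha : Continuous a) (hb : Continuous b) (hc : Continuous c)
    (hac : ∀ x r s, r * s * a x ≤ r ^ 2 * c x + K * s ^ 2)
    (hbc : ∀ x r s, r * s * b x ≤ r ^ 2 * c x + K * s ^ 2)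
    (hw : ∀ f : ℝ → ℝ, ContDiff ℝ 1 f → HasCompactSupport f →
      ∫ x : ℝ × ℝ, f x.1 * f x.2 * c x =
        ∫ x : ℝ × ℝ, (f x.1 * deriv f x.2 * a x - deriv f x.1 * f x.2 * b x)) (x : ℝ × ℝ) :
    c x = 0 := by
  have hc0 : ∀ x, 0 ≤ c x := fun x => by simpa using hac x 1 0
  set B : ℝ → Set (ℝ × ℝ) := fun R => Metric.closedBall 0 R with hB
  set E : ℝ → ℝ := fun R => ∫ x in B R, c x with hE
  have hBm : ∀ R, MeasurableSet (B R) := fun R => Metric.isClosed_closedBall.measurableSet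
  have hBi : ∀ R, IntegrableOn c (B R) := fun R =>
    hc.continuousOn.integrableOn_compact (isCompact_closedBall _ _)
  have hBv : ∀ R k : ℝ, 0 ≤ R → ∫ x, (B R).indicator (fun _ => k) x = 4 * R ^ 2 * k := by
    intro R k hR
    rw [integral_indicator_const _ (hBm R), volume_real_closedBall_prod hR, smul_eq_mul]
  have hBki : ∀ R k : ℝ, Integrable ((B R).indicator (fun _ : ℝ × ℝ => k)) := fun R k =>
    (integrable_indicator_iff (hBm R)).2 (continuousOn_const.integrableOn_compact
      (isCompact_closedBall _ _))
  obtain ⟨M, hM⟩ := exists_cutoff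
  have key : ∀ R : ℝ, 0 < R → E R ≤ 1024 * K * M ^ 2 ∧
      ∀ d : ℝ, 0 < d → E R ≤ 2 * d ^ 2 * (E (2 * R) - E R) + 128 * K * M ^ 2 / d ^ 2 := by
    intro R hR
    obtain ⟨φ, hφ, hφc, h0, h1, hone, hzero, hd0, hdM⟩ := hM R hR
    set m := M / R with hm
    have hdm : ∀ s, deriv φ s ^ 2 ≤ m ^ 2 := fun s => sq_le_sq' (abs_le.1 (hdM s)).1
      (abs_le.1 (hdM s)).2
    have hφcont := hφ.continuous
    have hφ'cont := hφ.continuous_deriv_one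
    have hf : ∀ s, deriv (fun s => φ s ^ 2) s = 2 * φ s * deriv φ s := fun s => by
      simpa using ((hφ.differentiable one_ne_zero s).hasDerivAt.fun_pow 2).deriv
    have hfc : HasCompactSupport (fun s => φ s ^ 2) := hφc.comp_left (g := fun y => y ^ 2) (by simp)
    have hint := hw (fun s => φ s ^ 2) (hφ.pow 2) hfc
    simp only [hf] at hint
    set J : ℝ × ℝ → ℝ := fun x => φ x.1 ^ 2 * (2 * φ x.2 * deriv φ x.2) * a x -
      2 * φ x.1 * deriv φ x.1 * φ x.2 ^ 2 * b x with hJ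
    set H : ℝ × ℝ → ℝ := fun x => φ x.1 ^ 2 * φ x.2 ^ 2 * c x with hH
    have hHi : Integrable H := Continuous.integrable_of_hasCompactSupport (by fun_prop)
      (hasCompactSupport_mul_prod hfc hfc).mul_right
    have hfc' : HasCompactSupport (fun s => 2 * φ s * deriv φ s) := hφc.deriv.mul_left
    have hJi : Integrable J := Continuous.integrable_of_hasCompactSupport (by fun_prop)
      ((hasCompactSupport_mul_prod hfc hfc').mul_right.sub
        (hasCompactSupport_mul_prod hfc' hfc).mul_right)
    have hEH : E R ≤ ∫ x, H x := by
      simp only [hE]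
      rw [← integral_indicator (hBm R)]
      refine integral_mono ((integrable_indicator_iff (hBm R)).2 (hBi R)) hHi fun x => ?_
      refine indicator_le' (fun x hx => ?_) (fun x _ => ?_) x
      · obtain ⟨hx1, hx2⟩ := mem_closedBall_zero_prod.1 hx
        simp [hH, hone _ hx1, hone _ hx2]
      · have := hc0 x
        positivity
    have hout : ∀ x ∉ B (2 * R), J x = 0 ∧ H x = 0 := by
      intro x hx
      have hx' : φ x.1 = 0 ∨ φ x.2 = 0 := by
        rw [hB, mem_closedBall_zero_prod, not_and_or, not_le, not_le] at hx
        exact hx.imp (hzero _) (hzero _)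
      rcases hx' with h | h <;> simp [hJ, hH, h]
    have hprod : ∀ y z, (φ y * deriv φ z) ^ 2 ≤ m ^ 2 := fun y z => by
      rw [mul_pow]
      exact (mul_le_of_le_one_left (sq_nonneg _) (pow_le_one₀ (h0 y) (h1 y))).trans (hdm z)
    have hmR : m ^ 2 * R ^ 2 = M ^ 2 := by rw [← mul_pow, hm, div_mul_cancel₀ _ hR.ne']
    refine ⟨?_, fun d hd => ?_⟩
    · have hJle : ∫ x, J x ≤
          ∫ x, (1 / 2 * H x + (B (2 * R)).indicator (fun _ => 32 * K * m ^ 2) x) := by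
        refine integral_mono hJi ((hHi.const_mul _).add (hBki _ _)) fun x => ?_
        by_cases hx : x ∈ B (2 * R)
        · simp only [indicator_of_mem hx]
          have e1 := hac x (φ x.1 * φ x.2 / 2) (4 * (φ x.1 * deriv φ x.2))
          have e2 := hbc x (φ x.1 * φ x.2 / 2) (-(4 * (φ x.2 * deriv φ x.1)))
          have e3 := mul_le_mul_of_nonneg_left (hprod x.1 x.2) hK
          have e4 := mul_le_mul_of_nonneg_left (hprod x.2 x.1) hK
          simp only [hJ, hH]
          linear_combination e1 + e2 + 16 * e3 + 16 * e4
        · simp [indicator_of_notMem hx, hout x hx]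
      rw [integral_add (hHi.const_mul _) (hBki _ _), integral_const_mul,
        hBv _ _ (by positivity)] at hJle
      linear_combination hEH + 2 * hJle + 2 * hint + 1024 * K * hmR
    · have hprod' : ∀ y z, (φ y ^ 2 * φ z * deriv φ z) ^ 2 ≤ m ^ 2 := fun y z => by
        have h : 0 ≤ φ y * φ z := mul_nonneg (h0 y) (h0 z)
        have h' : φ y * φ z ≤ 1 := mul_le_one₀ (h1 y) (h0 z) (h1 z)
        calc (φ y ^ 2 * φ z * deriv φ z) ^ 2
            = (φ y * φ z) ^ 2 * (φ y * deriv φ z) ^ 2 := by ring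
          _ ≤ (φ y * deriv φ z) ^ 2 :=
            mul_le_of_le_one_left (sq_nonneg _) (pow_le_one₀ h h')
          _ ≤ m ^ 2 := hprod y z
      have hci : ∀ R, Integrable ((B R).indicator c) := fun R =>
        (integrable_indicator_iff (hBm R)).2 (hBi R)
      have hci' : Integrable
          (fun x => 2 * d ^ 2 * ((B (2 * R)).indicator c x - (B R).indicator c x)) :=
        ((hci (2 * R)).sub (hci R)).const_mul _
      have hJle : ∫ x, J x ≤ ∫ x, (2 * d ^ 2 * ((B (2 * R)).indicator c x - (B R).indicator c x) +
          (B (2 * R)).indicator (fun _ => 8 * K * m ^ 2 / d ^ 2) x) := by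
        refine integral_mono hJi (hci'.add (hBki _ _)) fun x => ?_
        by_cases hx : x ∈ B (2 * R)
        · by_cases hx1 : x ∈ B R
          · obtain ⟨hx2, hx3⟩ := mem_closedBall_zero_prod.1 hx1
            simp only [indicator_of_mem hx, indicator_of_mem hx1, hJ, hd0 _ hx2, hd0 _ hx3]
            ring_nf
            positivity
          · simp only [indicator_of_mem hx, indicator_of_notMem hx1]
            have e1 := hac x d (2 * (φ x.1 ^ 2 * φ x.2 * deriv φ x.2) / d)
            have e2 := hbc x d (-(2 * (φ x.2 ^ 2 * φ x.1 * deriv φ x.1)) / d)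
            have hKd : 0 ≤ K / d ^ 2 := by positivity
            have e3 := mul_le_mul_of_nonneg_left (hprod' x.1 x.2) hKd
            have e4 := mul_le_mul_of_nonneg_left (hprod' x.2 x.1) hKd
            rw [mul_div_cancel₀ _ hd.ne', div_pow] at e1 e2
            simp only [hJ]
            linear_combination e1 + e2 + 4 * e3 + 4 * e4
        · have hx1 : x ∉ B R := fun h =>
            hx (Metric.closedBall_subset_closedBall (by linarith) h)
          simp [indicator_of_notMem hx, indicator_of_notMem hx1, hout x hx]
      rw [integral_add hci' (hBki _ _), integral_const_mul,
        integral_sub (hci _) (hci _), integral_indicator (hBm _), integral_indicator (hBm _),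
        hBv _ _ (by positivity)] at hJle
      linear_combination hEH + hJle + hint + 128 * K / d ^ 2 * hmR
  have hmono : Monotone E := fun R S hRS => setIntegral_mono_set (hBi S) (.of_forall hc0)
    (Metric.closedBall_subset_closedBall hRS).eventuallyLE
  set e : ℕ → ℝ := fun n => E (2 ^ n) with he
  have hemono : Monotone e := fun n k h => hmono (pow_le_pow_right₀ one_le_two h)
  obtain ⟨L, hL⟩ : ∃ L, Tendsto e atTop (𝓝 L) :=
    ⟨_, tendsto_atTop_ciSup hemono
      ⟨1024 * K * M ^ 2, forall_mem_range.2 fun n => (key _ (by positivity)).1⟩⟩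
  have hLd : ∀ d : ℝ, 0 < d → L ≤ 128 * K * M ^ 2 / d ^ 2 := by
    intro d hd
    have h1 : Tendsto (fun n => 2 * d ^ 2 * (e (n + 1) - e n) + 128 * K * M ^ 2 / d ^ 2) atTop
        (𝓝 (2 * d ^ 2 * (L - L) + 128 * K * M ^ 2 / d ^ 2)) :=
      ((((tendsto_add_atTop_iff_nat 1).2 hL).sub hL).const_mul _).add_const _
    have h2 := le_of_tendsto_of_tendsto' hL h1 fun n => by
      have := (key (2 ^ n) (by positivity)).2 d hd
      simpa only [he, pow_succ'] using this
    simpa using h2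
  have hL0 : L ≤ 0 := by
    have h : Tendsto (fun d : ℝ => 128 * K * M ^ 2 / d ^ 2) atTop (𝓝 0) :=
      tendsto_const_nhds.div_atTop (tendsto_pow_atTop two_ne_zero)
    exact ge_of_tendsto h ((eventually_gt_atTop 0).mono hLd)
  obtain ⟨n, hn⟩ := pow_unbounded_of_one_lt ‖x‖ (one_lt_two (α := ℝ))
  have hEn : ∫ x in B (2 ^ n), c x = 0 :=
    le_antisymm ((hemono.ge_of_tendsto hL n).trans hL0) (integral_nonneg hc0)
  rw [setIntegral_eq_zero_iff_of_nonneg_ae (.of_forall hc0) (hBi _)] at hEn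
  exact Measure.eqOn_open_of_ae_eq (ae_restrict_of_ae_restrict_of_subset
    Metric.ball_subset_closedBall hEn) Metric.isOpen_ball hc.continuousOn continuousOn_const
    (mem_ball_zero_iff.2 hn)

/-- A scaled form of the Cauchy-Schwarz inequality on `[0, 1]`. -/
theorem mul_intervalIntegral_le {g h : ℝ → ℝ} (hg : Continuous g) (hh : Continuous h) {K : ℝ}
    (hK : ∫ q in (0 : ℝ)..1, h q ^ 2 ≤ K) (r s : ℝ) :
    r * s * ∫ q in (0 : ℝ)..1, h q * g q ≤ r ^ 2 * (∫ q in (0 : ℝ)..1, g q ^ 2) + K * s ^ 2 := by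
  have hle : ∫ q in (0 : ℝ)..1, r * s * (h q * g q) ≤
      ∫ q in (0 : ℝ)..1, (r ^ 2 * g q ^ 2 + s ^ 2 * h q ^ 2) :=
    intervalIntegral.integral_mono_on zero_le_one
      (Continuous.intervalIntegrable (by fun_prop) _ _)
      (Continuous.intervalIntegrable (by fun_prop) _ _)
      fun q _ => by nlinarith [sq_nonneg (r * g q - s * h q), sq_nonneg (r * g q + s * h q)]
  rw [intervalIntegral.integral_add (Continuous.intervalIntegrable (by fun_prop) _ _)
    (Continuous.intervalIntegrable (by fun_prop) _ _)] at hle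
  simp only [intervalIntegral.integral_const_mul] at hle
  linear_combination hle + s ^ 2 * hK

/-- Let `u(q,t)` be `C²`, `1`-periodic in `q`, with
`∫₀¹ u_q(q,t)² dq < K` for all `t` (for some `K > 0`).  Let `ω(p,q,t)` be `C¹`,
`1`-periodic in `q`, satisfying the Riccati-type equation
`ω_t + p·ω_q − u_q·ω_p + ω² + u_qq = 0` everywhere.  Then `ω ≡ 0` and `u_q ≡ 0`. -/
theorem riccati_solution_and_force_vanish
    (u : ℝ → ℝ → ℝ) (hu : ContDiff ℝ 2 (fun x : ℝ × ℝ => u x.1 x.2))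
    (huper : ∀ q t, u (q + 1) t = u q t)
    (uq uqq : ℝ → ℝ → ℝ)
    (huq : ∀ q t, HasDerivAt (fun q' => u q' t) (uq q t) q)
    (huqq : ∀ q t, HasDerivAt (fun q' => uq q' t) (uqq q t) q)
    (K : ℝ) (hK : 0 < K)
    (hbound : ∀ t, (∫ q in (0:ℝ)..1, (uq q t) ^ 2) < K)
    (ω : ℝ → ℝ → ℝ → ℝ)
    (hω : ContDiff ℝ 1 (fun x : ℝ × ℝ × ℝ => ω x.1 x.2.1 x.2.2))
    (hωper : ∀ p q t, ω p (q + 1) t = ω p q t)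
    (ωp ωq ωt : ℝ → ℝ → ℝ → ℝ)
    (hωp : ∀ p q t, HasDerivAt (fun p' => ω p' q t) (ωp p q t) p)
    (hωq : ∀ p q t, HasDerivAt (fun q' => ω p q' t) (ωq p q t) q)
    (hωt : ∀ p q t, HasDerivAt (fun t' => ω p q t') (ωt p q t) t)
    (hric : ∀ p q t,
      ωt p q t + p * ωq p q t - uq q t * ωp p q t + (ω p q t) ^ 2 + uqq q t = 0) :
    (∀ p q t, ω p q t = 0) ∧ (∀ q t, uq q t = 0) := by
  have huq_per : ∀ q t, uq (q + 1) t = uq q t := fun q t => by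
    have h : HasDerivAt (fun q' => u q' t) (uq (q + 1) t) q := by
      simpa only [huper] using (huq (q + 1) t).comp_add_const q 1
    exact h.unique (huq q t)
  have huq1 : ContDiff ℝ 1 (fun x : ℝ × ℝ => uq x.1 x.2) := by
    have h : (fun x : ℝ × ℝ => uq x.1 x.2) =
        fun x => fderiv ℝ (fun x : ℝ × ℝ => u x.1 x.2) x (1, 0) := by
      ext x
      have h := (hu.differentiable two_ne_zero x).hasFDerivAt.comp_hasDerivAt_of_eq x.1
        ((hasDerivAt_id x.1).prodMk (hasDerivAt_const x.1 x.2)) rfl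
      exact (huq x.1 x.2).unique h
    rw [h]
    exact (hu.fderiv_right le_rfl).clm_apply contDiff_const
  have huqc := huq1.continuous
  have huqqc : Continuous (fun x : ℝ × ℝ => uqq x.1 x.2) := by
    have h : (fun x : ℝ × ℝ => uqq x.1 x.2) =
        fun x => fderiv ℝ (fun x : ℝ × ℝ => uq x.1 x.2) x (1, 0) := by
      ext x
      have h := (huq1.differentiable one_ne_zero x).hasFDerivAt.comp_hasDerivAt_of_eq x.1
        ((hasDerivAt_id x.1).prodMk (hasDerivAt_const x.1 x.2)) rfl
      exact (huqq x.1 x.2).unique h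
    rw [h]
    exact (huq1.continuous_fderiv one_ne_zero).clm_apply continuous_const
  have hωc := hω.continuous
  have hω' : ∀ v, Continuous fun x : ℝ × ℝ × ℝ =>
      fderiv ℝ (fun x : ℝ × ℝ × ℝ => ω x.1 x.2.1 x.2.2) x v := fun v =>
    (hω.continuous_fderiv one_ne_zero).clm_apply continuous_const
  have hωd := fun x => (hω.differentiable one_ne_zero x).hasFDerivAt
  have hωpc : Continuous fun x : ℝ × ℝ × ℝ => ωp x.1 x.2.1 x.2.2 := by
    refine (hω' (1, 0, 0)).congr fun x => ?_
    exact ((hωd x).comp_hasDerivAt_of_eq x.1 ((hasDerivAt_id x.1).prodMk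
      (hasDerivAt_const x.1 x.2)) rfl).unique (hωp x.1 x.2.1 x.2.2)
  have hωqc : Continuous fun x : ℝ × ℝ × ℝ => ωq x.1 x.2.1 x.2.2 := by
    refine (hω' (0, 1, 0)).congr fun x => ?_
    exact ((hωd x).comp_hasDerivAt_of_eq x.2.1 ((hasDerivAt_const x.2.1 x.1).prodMk
      ((hasDerivAt_id x.2.1).prodMk (hasDerivAt_const x.2.1 x.2.2))) rfl).unique (hωq _ _ _)
  have hωtc : Continuous fun x : ℝ × ℝ × ℝ => ωt x.1 x.2.1 x.2.2 := by
    refine (hω' (0, 0, 1)).congr fun x => ?_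
    exact ((hωd x).comp_hasDerivAt_of_eq x.2.2 ((hasDerivAt_const x.2.2 x.1).prodMk
      ((hasDerivAt_const x.2.2 x.2.1).prodMk (hasDerivAt_id x.2.2))) rfl).unique (hωt _ _ _)
  have cω : Continuous (fun y : (ℝ × ℝ) × ℝ => ω y.1.1 y.2 y.1.2) :=
    hωc.comp (f := fun y : (ℝ × ℝ) × ℝ => (y.1.1, y.2, y.1.2)) (by fun_prop)
  have cωp : Continuous (fun y : (ℝ × ℝ) × ℝ => ωp y.1.1 y.2 y.1.2) :=
    hωpc.comp (f := fun y : (ℝ × ℝ) × ℝ => (y.1.1, y.2, y.1.2)) (by fun_prop)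
  have cωq : Continuous (fun y : (ℝ × ℝ) × ℝ => ωq y.1.1 y.2 y.1.2) :=
    hωqc.comp (f := fun y : (ℝ × ℝ) × ℝ => (y.1.1, y.2, y.1.2)) (by fun_prop)
  have cωt : Continuous (fun y : (ℝ × ℝ) × ℝ => ωt y.1.1 y.2 y.1.2) :=
    hωtc.comp (f := fun y : (ℝ × ℝ) × ℝ => (y.1.1, y.2, y.1.2)) (by fun_prop)
  have cuq : Continuous (fun y : (ℝ × ℝ) × ℝ => uq y.2 y.1.2) :=
    huqc.comp (f := fun y : (ℝ × ℝ) × ℝ => (y.2, y.1.2)) (by fun_prop)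
  have cuqq : Continuous (fun y : (ℝ × ℝ) × ℝ => uqq y.2 y.1.2) :=
    huqqc.comp (f := fun y : (ℝ × ℝ) × ℝ => (y.2, y.1.2)) (by fun_prop)
  have sec : ∀ {G : (ℝ × ℝ) × ℝ → ℝ}, Continuous G → ∀ x, Continuous fun q => G (x, q) :=
    fun hG x => hG.comp (Continuous.prodMk_right x)
  have sec' : ∀ {G : (ℝ × ℝ) × ℝ → ℝ}, Continuous G → ∀ q, Continuous fun x => G (x, q) :=
    fun hG q => hG.comp (Continuous.prodMk_left q)
  set a : ℝ × ℝ → ℝ := fun x => ∫ q in (0 : ℝ)..1, ω x.1 q x.2 with ha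
  set b : ℝ × ℝ → ℝ := fun x => ∫ q in (0 : ℝ)..1, uq q x.2 * ω x.1 q x.2 with hb
  set c : ℝ × ℝ → ℝ := fun x => ∫ q in (0 : ℝ)..1, ω x.1 q x.2 ^ 2 with hc
  have hcont : ∀ {G : (ℝ × ℝ) × ℝ → ℝ}, Continuous G →
      Continuous fun x => ∫ q in (0 : ℝ)..1, G (x, q) := fun {G} hG =>
    intervalIntegral.continuous_parametric_intervalIntegral_of_continuous'
      (f := fun x q => G (x, q)) hG 0 1
  have hca : Continuous a := hcont cω
  have hcb : Continuous b := hcont (cuq.mul cω)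
  have hcc : Continuous c := hcont (cω.pow 2)
  have hweak : ∀ f : ℝ → ℝ, ContDiff ℝ 1 f → HasCompactSupport f →
      ∫ x : ℝ × ℝ, f x.1 * f x.2 * c x =
        ∫ x : ℝ × ℝ, (f x.1 * deriv f x.2 * a x - deriv f x.1 * f x.2 * b x) := by
    intro f hf hfc
    have hfcont := hf.continuous
    have hf'cont := hf.continuous_deriv_one
    set T : ℝ × ℝ → ℝ → ℝ := fun x q =>
      f x.1 * deriv f x.2 * ω x.1 q x.2 + f x.1 * f x.2 * ωt x.1 q x.2 with hT
    set P : ℝ × ℝ → ℝ → ℝ := fun x q => deriv f x.1 * f x.2 * (uq q x.2 * ω x.1 q x.2) +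
      f x.1 * f x.2 * (uq q x.2 * ωp x.1 q x.2) with hP
    have hTc : Continuous (Function.uncurry T) := by
      simp only [hT, Function.uncurry_def]; fun_prop
    have hPc : Continuous (Function.uncurry P) := by
      simp only [hP, Function.uncurry_def]; fun_prop
    have hsupp : ∀ x ∉ tsupport f ×ˢ tsupport f, ∀ q, P x q - T x q = 0 := by
      intro x hx q
      by_cases h : x.1 ∈ tsupport f
      · have h2 : x.2 ∉ tsupport f := fun h2 => hx ⟨h, h2⟩
        have h3 : deriv f x.2 = 0 :=
          image_eq_zero_of_notMem_tsupport fun h3 => h2 (tsupport_deriv_subset h3)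
        simp [hP, hT, image_eq_zero_of_notMem_tsupport h2, h3]
      · have h3 : deriv f x.1 = 0 :=
          image_eq_zero_of_notMem_tsupport fun h3 => h (tsupport_deriv_subset h3)
        simp [hP, hT, image_eq_zero_of_notMem_tsupport h, h3]
    have hsl : ∀ x, f x.1 * f x.2 * c x - (f x.1 * deriv f x.2 * a x -
        deriv f x.1 * f x.2 * b x) = ∫ q in (0 : ℝ)..1, (P x q - T x q) := by
      intro x
      have s0 := sec cω x
      have s1 := sec cωp x
      have s2 := sec cωq x
      have s3 := sec cωt x
      have s4 := sec cuq x
      have s5 := sec cuqq x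
      have hper : ∫ q in (0 : ℝ)..1, (x.1 * ωq x.1 q x.2 + uqq q x.2) = 0 := by
        rw [intervalIntegral.integral_eq_sub_of_hasDerivAt
          (f := fun q => x.1 * ω x.1 q x.2 + uq q x.2)
          (fun q _ => ((hωq _ _ _).const_mul _).add (huqq _ _))
          (Continuous.intervalIntegrable (by fun_prop) _ _)]
        have h1 := hωper x.1 0 x.2
        have h2 := huq_per 0 x.2
        rw [zero_add] at h1 h2
        rw [h1, h2, sub_self]
      have hpt : ∀ q, P x q - T x q = f x.1 * f x.2 * ω x.1 q x.2 ^ 2 -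
          f x.1 * deriv f x.2 * ω x.1 q x.2 + deriv f x.1 * f x.2 * (uq q x.2 * ω x.1 q x.2) +
          f x.1 * f x.2 * (x.1 * ωq x.1 q x.2 + uqq q x.2) := fun q => by
        simp only [hP, hT]
        linear_combination -(f x.1 * f x.2) * hric x.1 q x.2
      simp only [hpt]
      rw [intervalIntegral.integral_add (Continuous.intervalIntegrable (by fun_prop) _ _)
          (Continuous.intervalIntegrable (by fun_prop) _ _),
        intervalIntegral.integral_add (Continuous.intervalIntegrable (by fun_prop) _ _)
          (Continuous.intervalIntegrable (by fun_prop) _ _),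
        intervalIntegral.integral_sub (Continuous.intervalIntegrable (by fun_prop) _ _)
          (Continuous.intervalIntegrable (by fun_prop) _ _)]
      simp only [intervalIntegral.integral_const_mul, hper, ha, hb, hc]
      ring
    have hTi : ∀ q, Integrable fun x => T x q := fun q =>
      Continuous.integrable_of_hasCompactSupport (sec' hTc q)
        ((hasCompactSupport_mul_prod hfc hfc.deriv).mul_right.add
          (hasCompactSupport_mul_prod hfc hfc).mul_right)
    have hPi : ∀ q, Integrable fun x => P x q := fun q =>
      Continuous.integrable_of_hasCompactSupport (sec' hPc q)
        ((hasCompactSupport_mul_prod hfc.deriv hfc).mul_right.add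
          (hasCompactSupport_mul_prod hfc hfc).mul_right)
    have hT0 : ∀ q, ∫ x, T x q = 0 := fun q =>
      integral_deriv_snd_mul_eq_zero hf hfc (sec' cω q) (sec' cωt q) fun _ _ => hωt _ _ _
    have hP0 : ∀ q, ∫ x, P x q = 0 := fun q =>
      integral_deriv_fst_mul_eq_zero hf hfc (sec' (cuq.mul cω) q) (sec' (cuq.mul cωp) q)
        fun x y => (hωp x q y).const_mul (uq q y)
    have hzero : ∫ x, ∫ q in (0 : ℝ)..1, (P x q - T x q) = 0 := by
      rw [integral_intervalIntegral_swap_of_compact (F := fun x q => P x q - T x q) (hPc.sub hTc)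
        (IsCompact.prod hfc hfc) hsupp]
      simp [integral_sub (hPi _) (hTi _), hT0, hP0]
    have hi1 : Integrable fun x : ℝ × ℝ => f x.1 * f x.2 * c x :=
      Continuous.integrable_of_hasCompactSupport (by fun_prop)
        (hasCompactSupport_mul_prod hfc hfc).mul_right
    have hi2 : Integrable fun x : ℝ × ℝ =>
        f x.1 * deriv f x.2 * a x - deriv f x.1 * f x.2 * b x :=
      Continuous.integrable_of_hasCompactSupport (by fun_prop)
        ((hasCompactSupport_mul_prod hfc hfc.deriv).mul_right.sub
          (hasCompactSupport_mul_prod hfc.deriv hfc).mul_right)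
    simp only [← hsl] at hzero
    rw [integral_sub hi1 hi2] at hzero
    exact sub_eq_zero.1 hzero
  have hc0 : ∀ x, c x = 0 := by
    refine eq_zero_of_sq_le_weak_divergence (K := 1 + K) (by positivity) hca hcb hcc
      (fun x r s => ?_) (fun x r s => ?_) hweak
    · simpa using mul_intervalIntegral_le (sec cω x) (h := fun _ => 1) continuous_const
        (K := 1 + K) (by simpa using hK.le) r s
    · exact mul_intervalIntegral_le (sec cω x) (sec cuq x)
        (by linarith [hbound x.2]) r s
  have hω01 : ∀ p t, ∀ q ∈ Icc (0 : ℝ) 1, ω p q t = 0 := by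
    intro p t q hq
    by_contra hne
    have hs : Continuous fun q => ω p q t := sec cω (p, t)
    have := intervalIntegral.integral_pos (f := fun q => ω p q t ^ 2) one_pos
      (by fun_prop) (fun _ _ => sq_nonneg _) ⟨q, hq, by positivity⟩
    exact this.ne' (hc0 (p, t))
  have hω0 : ∀ p q t, ω p q t = 0 := by
    intro p q t
    have hp : Function.Periodic (fun q => ω p q t) 1 := fun q => hωper p q t
    obtain ⟨y, hy, hqy⟩ := hp.exists_mem_Ico₀ one_pos q
    exact hqy.trans (hω01 p t y (Ico_subset_Icc_self hy))
  refine ⟨hω0, fun q t => ?_⟩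
  have huqq0 : ∀ q t, uqq q t = 0 := fun q t => by
    have h1 : ωt 0 q t = 0 := (hωt 0 q t).unique (by simpa [hω0] using hasDerivAt_const t (0 : ℝ))
    have h2 : ωp 0 q t = 0 :=
      (hωp 0 q t).unique (by simpa [hω0] using hasDerivAt_const (0 : ℝ) (0 : ℝ))
    simpa [h1, h2, hω0] using hric 0 q t
  have hconst : ∀ y, uq y t = uq q t := fun y =>
    is_const_of_deriv_eq_zero (f := fun y => uq y t)
      (fun y => (huqq y t).differentiableAt) (fun y => (huqq y t).deriv.trans (huqq0 y t)) y q
  have h := intervalIntegral.integral_eq_sub_of_hasDerivAt (a := 0) (b := 1)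
    (f := fun y => u y t) (f' := fun _ => uq q t)
    (fun y _ => hconst y ▸ huq y t) (by simp)
  have h1 := huper 0 t
  rw [zero_add] at h1
  simpa [h1] using h
end

section
/- Let u : ℝ × ℝ → ℝ be a C² function with u(q+1, t) = u(q, t), and let ω : ℝ³ → ℝ be a C¹ function, 1-periodic in q, satisfying ω_t + p·ω_q − u_q·ω_p + ω² + u_qq = 0 everywhere. Define V₁(p,t) = −∫₀¹ ω(p,q,t) dq and V₂(p,t) = ∫₀¹ ω(p,q,t)·u_q(q,t) dq. Then for all (p,t), ∂V₁/∂t (p,t) + ∂V₂/∂p (p,t) = ∫₀¹ ω(p,q,t)² dq. -/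
/-- Differentiation under the integral sign over a compact interval, for an integrand whose
derivative in the parameter is jointly continuous. -/
theorem hasDerivAt_intervalIntegral_of_continuous {F F' : ℝ → ℝ → ℝ} {a b : ℝ}
    (hF : ∀ x, Continuous (F x)) (hF' : Continuous fun z : ℝ × ℝ => F' z.1 z.2)
    (hderiv : ∀ x s, HasDerivAt (fun y => F y s) (F' x s) x) (x₀ : ℝ) :
    HasDerivAt (fun x => ∫ s in a..b, F x s) (∫ s in a..b, F' x₀ s) x₀ := by
  have hK : IsCompact (Metric.closedBall x₀ 1 ×ˢ Set.uIcc a b) :=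
    (isCompact_closedBall x₀ 1).prod isCompact_uIcc
  obtain ⟨C, hC⟩ := hK.exists_bound_of_continuousOn hF'.continuousOn
  refine (intervalIntegral.hasDerivAt_integral_of_dominated_loc_of_deriv_le
    (bound := fun _ => C) (Metric.closedBall_mem_nhds x₀ one_pos)
    (Filter.Eventually.of_forall fun x => (hF x).aestronglyMeasurable)
    ((hF x₀).intervalIntegrable a b)
    (hF'.comp (Continuous.prodMk_right x₀)).aestronglyMeasurable
    (Filter.Eventually.of_forall fun s hs x hx => ?_)
    intervalIntegrable_const
    (Filter.Eventually.of_forall fun s _ x _ => hderiv x s)).2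
  exact hC (x, s) ⟨hx, Set.uIoc_subset_uIcc hs⟩

/-- The integral of a continuous derivative over a period of the primitive vanishes. -/
theorem integral_deriv_eq_zero_of_periodic {f f' : ℝ → ℝ} (hf : ∀ x, HasDerivAt f (f' x) x)
    (hf' : Continuous f') (hper : f (0 + 1) = f 0) : ∫ x in (0:ℝ)..1, f' x = 0 := by
  rw [intervalIntegral.integral_eq_sub_of_hasDerivAt (fun x _ => hf x)
    (hf'.intervalIntegrable 0 1)]
  rw [zero_add] at hper
  rw [hper, sub_self]

theorem fderiv_apply_eq_of_hasDerivAt_comp {E : Type*} [NormedAddCommGroup E] [NormedSpace ℝ E]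
    {f : E → ℝ} {c : ℝ → E} {v : E} {d s : ℝ} (hf : Differentiable ℝ f)
    (hc : HasDerivAt c v s) (hd : HasDerivAt (fun r => f (c r)) d s) :
    d = fderiv ℝ f (c s) v :=
  hd.unique ((hf (c s)).hasFDerivAt.comp_hasDerivAt s hc)

/-- Integrating the Riccati-type equation
`ω_t + p·ω_q − u_q·ω_p + ω² + u_qq = 0` over one period in `q` yields, for
`V₁(p,t) = −∫₀¹ ω dq` and `V₂(p,t) = ∫₀¹ ω·u_q dq`, the divergence identity
`∂V₁/∂t + ∂V₂/∂p = ∫₀¹ ω² dq`. -/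
theorem integrated_riccati_divergence_identity
    (u : ℝ → ℝ → ℝ) (hu : ContDiff ℝ 2 (fun x : ℝ × ℝ => u x.1 x.2))
    (huper : ∀ q t, u (q + 1) t = u q t)
    (uq uqq : ℝ → ℝ → ℝ)
    (huq : ∀ q t, HasDerivAt (fun q' => u q' t) (uq q t) q)
    (huqq : ∀ q t, HasDerivAt (fun q' => uq q' t) (uqq q t) q)
    (ω : ℝ → ℝ → ℝ → ℝ)
    (hω : ContDiff ℝ 1 (fun x : ℝ × ℝ × ℝ => ω x.1 x.2.1 x.2.2))
    (hωper : ∀ p q t, ω p (q + 1) t = ω p q t)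
    (ωp ωq ωt : ℝ → ℝ → ℝ → ℝ)
    (hωp : ∀ p q t, HasDerivAt (fun p' => ω p' q t) (ωp p q t) p)
    (hωq : ∀ p q t, HasDerivAt (fun q' => ω p q' t) (ωq p q t) q)
    (hωt : ∀ p q t, HasDerivAt (fun t' => ω p q t') (ωt p q t) t)
    (hric : ∀ p q t,
      ωt p q t + p * ωq p q t - uq q t * ωp p q t + (ω p q t) ^ 2 + uqq q t = 0)
    (V₁ V₂ : ℝ → ℝ → ℝ)
    (hV₁ : ∀ p t, V₁ p t = -∫ q in (0:ℝ)..1, ω p q t)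
    (hV₂ : ∀ p t, V₂ p t = ∫ q in (0:ℝ)..1, ω p q t * uq q t) :
    ∀ p t, ∃ a b : ℝ,
      HasDerivAt (fun t' => V₁ p t') a t ∧
      HasDerivAt (fun p' => V₂ p' t) b p ∧
      a + b = ∫ q in (0:ℝ)..1, (ω p q t) ^ 2 := by
  have hW := hω.differentiable one_ne_zero
  have hdW : ∀ v, Continuous fun x => fderiv ℝ (fun x : ℝ × ℝ × ℝ => ω x.1 x.2.1 x.2.2) x v :=
    fun v => (hω.continuous_fderiv one_ne_zero).clm_apply continuous_const
  have hωp_cont : Continuous fun x : ℝ × ℝ × ℝ => ωp x.1 x.2.1 x.2.2 :=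
    (hdW (1, 0, 0)).congr fun x => (fderiv_apply_eq_of_hasDerivAt_comp hW
      (c := fun r => (r, x.2.1, x.2.2)) ((hasDerivAt_id x.1).prodMk (hasDerivAt_const _ _))
      (hωp x.1 x.2.1 x.2.2)).symm
  have hωq_cont : Continuous fun x : ℝ × ℝ × ℝ => ωq x.1 x.2.1 x.2.2 :=
    (hdW (0, 1, 0)).congr fun x => (fderiv_apply_eq_of_hasDerivAt_comp hW
      (c := fun r => (x.1, r, x.2.2))
      ((hasDerivAt_const _ _).prodMk ((hasDerivAt_id x.2.1).prodMk (hasDerivAt_const _ _)))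
      (hωq x.1 x.2.1 x.2.2)).symm
  have hωt_cont : Continuous fun x : ℝ × ℝ × ℝ => ωt x.1 x.2.1 x.2.2 :=
    (hdW (0, 0, 1)).congr fun x => (fderiv_apply_eq_of_hasDerivAt_comp hW
      (c := fun r => (x.1, x.2.1, r))
      ((hasDerivAt_const _ _).prodMk ((hasDerivAt_const _ _).prodMk (hasDerivAt_id x.2.2)))
      (hωt x.1 x.2.1 x.2.2)).symm
  have huq_contDiff : ContDiff ℝ 1 fun x : ℝ × ℝ => uq x.1 x.2 := by
    have h : (fun x : ℝ × ℝ => uq x.1 x.2) =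
        fun x => fderiv ℝ (fun x : ℝ × ℝ => u x.1 x.2) x (1, 0) :=
      funext fun x => fderiv_apply_eq_of_hasDerivAt_comp (hu.differentiable two_ne_zero)
        (c := fun r => (r, x.2)) ((hasDerivAt_id x.1).prodMk (hasDerivAt_const _ _))
        (huq x.1 x.2)
    rw [h]
    exact (hu.fderiv_right (m := 1) (by norm_num)).clm_apply contDiff_const
  have huqq_cont : Continuous fun x : ℝ × ℝ => uqq x.1 x.2 :=
    ((huq_contDiff.continuous_fderiv one_ne_zero).clm_apply
      (continuous_const (y := ((1, 0) : ℝ × ℝ)))).congr fun x =>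
      (fderiv_apply_eq_of_hasDerivAt_comp (huq_contDiff.differentiable one_ne_zero)
        (c := fun r => (r, x.2)) ((hasDerivAt_id x.1).prodMk (hasDerivAt_const _ _))
        (huqq x.1 x.2)).symm
  have huq_per : ∀ q t, uq (q + 1) t = uq q t := fun q t => by
    have h := (huq (q + 1) t).comp_add_const q 1
    simp only [huper] at h
    exact h.unique (huq q t)
  intro p t
  have hslice : Continuous fun q : ℝ => (p, q, t) := by fun_prop
  have cω : Continuous fun q => ω p q t := hω.continuous.comp hslice
  have cωp : Continuous fun q => ωp p q t := hωp_cont.comp hslice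
  have cωq : Continuous fun q => ωq p q t := hωq_cont.comp hslice
  have cuq : Continuous fun q => uq q t :=
    huq_contDiff.continuous.comp (Continuous.prodMk_left t)
  have cuqq : Continuous fun q => uqq q t := huqq_cont.comp (Continuous.prodMk_left t)
  refine ⟨-∫ q in (0:ℝ)..1, ωt p q t, ∫ q in (0:ℝ)..1, ωp p q t * uq q t, ?_, ?_, ?_⟩
  · simp only [hV₁]
    refine (hasDerivAt_intervalIntegral_of_continuous (F := fun t q => ω p q t)
      (F' := fun t q => ωt p q t) (fun s => ?_) ?_ (fun s q => hωt p q s) t).neg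
    · exact hω.continuous.comp (g := fun x : ℝ × ℝ × ℝ => ω x.1 x.2.1 x.2.2)
        (f := fun q => (p, q, s)) (by fun_prop)
    · exact hωt_cont.comp (f := fun z : ℝ × ℝ => (p, z.2, z.1)) (by fun_prop)
  · simp only [hV₂]
    refine hasDerivAt_intervalIntegral_of_continuous (F := fun p q => ω p q t * uq q t)
      (F' := fun p q => ωp p q t * uq q t) (fun s => ?_) ?_
      (fun s q => (hωp s q t).mul_const _) p
    · exact (hω.continuous.comp (g := fun x : ℝ × ℝ × ℝ => ω x.1 x.2.1 x.2.2)
        (f := fun q => (s, q, t)) (by fun_prop)).mul cuq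
    · exact (hωp_cont.comp (f := fun z : ℝ × ℝ => (z.1, z.2, t)) (by fun_prop)).mul
        (cuq.comp continuous_snd)
  · have hq : ∫ q in (0:ℝ)..1, ωq p q t = 0 :=
      integral_deriv_eq_zero_of_periodic (fun q => hωq p q t) cωq (hωper p 0 t)
    have hqq : ∫ q in (0:ℝ)..1, uqq q t = 0 :=
      integral_deriv_eq_zero_of_periodic (fun q => huqq q t) cuqq (huq_per 0 t)
    have hsolve : ∀ q, ωt p q t =
        ωp p q t * uq q t - p * ωq p q t - ω p q t ^ 2 - uqq q t := fun q => by
      linear_combination hric p q t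
    have i₁ : IntervalIntegrable (fun q => ωp p q t * uq q t) MeasureTheory.volume 0 1 :=
      (cωp.mul cuq).intervalIntegrable 0 1
    have i₂ : IntervalIntegrable (fun q => p * ωq p q t) MeasureTheory.volume 0 1 :=
      (continuous_const.mul cωq).intervalIntegrable 0 1
    have i₃ : IntervalIntegrable (fun q => ω p q t ^ 2) MeasureTheory.volume 0 1 :=
      (cω.pow 2).intervalIntegrable 0 1
    simp only [hsolve]
    rw [intervalIntegral.integral_sub ((i₁.sub i₂).sub i₃) (cuqq.intervalIntegrable 0 1),
      intervalIntegral.integral_sub (i₁.sub i₂) i₃, intervalIntegral.integral_sub i₁ i₂,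
      intervalIntegral.integral_const_mul, hq, hqq]
    ring
end

section
/- Let u₀ ∈ ℝ and let u₁, u₂ : ℝ × ℝ → ℝ be smooth functions, 1-periodic in q, satisfying the system (u₁)_t = 2u₀·(u₁)_q − (u₂)_q and (u₂)_t = u₁·(u₁)_q on ℝ × ℝ, and suppose u₁(q,t) > u₀² for all (q,t). Then u₁ and u₂ are constant functions. -/
open MeasureTheory Set Filter Topology

/-- Differentiation under the integral sign over a compact interval, for a jointly continuous
integrand with jointly continuous derivative. -/
theorem hasDerivAt_intervalIntegral_of_continuous_s11 {f f' : ℝ × ℝ → ℝ} (hf : Continuous f)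
    (hf' : Continuous f') (hd : ∀ q t, HasDerivAt (fun s => f (q, s)) (f' (q, t)) t)
    (a b t : ℝ) :
    HasDerivAt (fun s => ∫ q in a..b, f (q, s)) (∫ q in a..b, f' (q, t)) t := by
  have hK : IsCompact (uIcc a b ×ˢ Icc (t - 1) (t + 1)) := isCompact_uIcc.prod isCompact_Icc
  obtain ⟨C, hC⟩ := hK.exists_bound_of_continuousOn hf'.continuousOn
  refine (intervalIntegral.hasDerivAt_integral_of_dominated_loc_of_deriv_le
    (F := fun s q => f (q, s)) (F' := fun s q => f' (q, s)) (bound := fun _ => C)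
    (Icc_mem_nhds (by linarith : t - 1 < t) (by linarith : t < t + 1))
    (Eventually.of_forall fun s => ?_) ?_ ?_ ?_ ?_ ?_).2
  · exact (by fun_prop : Continuous fun q => f (q, s)).aestronglyMeasurable
  · exact (by fun_prop : Continuous fun q => f (q, t)).intervalIntegrable _ _
  · exact (by fun_prop : Continuous fun q => f' (q, t)).aestronglyMeasurable
  · exact Eventually.of_forall fun q hq s hs => hC (q, s) ⟨uIoc_subset_uIcc hq, hs⟩
  · exact intervalIntegrable_const
  · exact Eventually.of_forall fun q _ s _ => hd q s

/-- A function on the line which is bounded below and above and has a monotone derivative has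
vanishing derivative. -/
theorem eq_zero_of_hasDerivAt_of_monotone_of_bounded {f g : ℝ → ℝ} {m M : ℝ}
    (hf : ∀ t, HasDerivAt f (g t) t) (hg : Monotone g) (hm : ∀ t, m ≤ f t) (hM : ∀ t, f t ≤ M)
    (t : ℝ) : g t = 0 := by
  have hconv : ConvexOn ℝ univ f := by
    refine MonotoneOn.convexOn_of_deriv convex_univ
      (fun x _ => (hf x).continuousAt.continuousWithinAt)
      (fun x _ => (hf x).differentiableAt.differentiableWithinAt) ?_
    rw [funext fun x => (hf x).deriv]
    exact hg.monotoneOn _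
  have tangent : ∀ s, f t + g t * (s - t) ≤ f s := by
    intro s
    rcases lt_trichotomy s t with h | rfl | h
    · have := hconv.slope_le_of_hasDerivAt (mem_univ s) (mem_univ t) h (hf t)
      rw [slope_def_field, div_le_iff₀ (by linarith)] at this
      linarith
    · simp
    · have := hconv.le_slope_of_hasDerivAt (mem_univ t) (mem_univ s) h (hf t)
      rw [slope_def_field, le_div_iff₀ (by linarith)] at this
      linarith
  by_contra hne
  have h := tangent (t + (M - m + 1) / g t)
  rw [add_sub_cancel_left, mul_div_cancel₀ _ hne] at h
  linarith [hm t, hM (t + (M - m + 1) / g t)]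

/-- The integral of the derivative of a `1`-periodic function over a period vanishes. -/
theorem integral_deriv_eq_zero_of_periodic_s11 {f f' : ℝ → ℝ} (hd : ∀ q, HasDerivAt f (f' q) q)
    (hf' : Continuous f') (hp : ∀ q, f (q + 1) = f q) (c : ℝ) :
    ∫ q in c..c + 1, f' q = 0 := by
  rw [intervalIntegral.integral_eq_sub_of_hasDerivAt (fun q _ => hd q)
    (hf'.intervalIntegrable _ _), hp, sub_self]

/-- Restricting a derivative on the plane to horizontal lines. -/
theorem HasFDerivAt.hasDerivAt_fst {f : ℝ × ℝ → ℝ} {f' : ℝ × ℝ →L[ℝ] ℝ} {q t : ℝ}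
    (h : HasFDerivAt f f' (q, t)) : HasDerivAt (fun s => f (s, t)) (f' (1, 0)) q :=
  h.comp_hasDerivAt q ((hasDerivAt_id q).prodMk (hasDerivAt_const q t))

/-- Restricting a derivative on the plane to vertical lines. -/
theorem HasFDerivAt.hasDerivAt_snd {f : ℝ × ℝ → ℝ} {f' : ℝ × ℝ →L[ℝ] ℝ} {q t : ℝ}
    (h : HasFDerivAt f f' (q, t)) : HasDerivAt (fun s => f (q, s)) (f' (0, 1)) t :=
  h.comp_hasDerivAt t ((hasDerivAt_const t q).prodMk (hasDerivAt_id t))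

/-- A `C²` function on the plane has continuous partial derivatives and a continuous mixed second
partial derivative, which does not depend on the order of differentiation. -/
theorem ContDiff.exists_partial_derivs {f : ℝ × ℝ → ℝ} (hf : ContDiff ℝ 2 f) :
    ∃ fq ft fqt : ℝ × ℝ → ℝ, Continuous fq ∧ Continuous ft ∧ Continuous fqt ∧
      (∀ q t, HasDerivAt (fun s => f (s, t)) (fq (q, t)) q) ∧
      (∀ q t, HasDerivAt (fun s => f (q, s)) (ft (q, t)) t) ∧
      (∀ q t, HasDerivAt (fun s => fq (q, s)) (fqt (q, t)) t) ∧
      (∀ q t, HasDerivAt (fun s => ft (s, t)) (fqt (q, t)) q) := by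
  have hD : ContDiff ℝ 1 (fderiv ℝ f) := hf.fderiv_right (by norm_num)
  have hDD : Continuous (fderiv ℝ (fderiv ℝ f)) := hD.continuous_fderiv (by norm_num)
  have hc := hD.continuous
  have h1 : ∀ x, HasFDerivAt f (fderiv ℝ f x) x := fun x =>
    (hf.differentiable (by norm_num) x).hasFDerivAt
  have h2 : ∀ x w, HasFDerivAt (fun y => fderiv ℝ f y w)
      ((fderiv ℝ (fderiv ℝ f) x).flip w) x := fun x w => by
    simpa using (hD.differentiable (by norm_num) x).hasFDerivAt.clm_apply (hasFDerivAt_const w x)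
  have hsymm : ∀ x, IsSymmSndFDerivAt ℝ f x := fun x =>
    hf.contDiffAt.isSymmSndFDerivAt (by simp)
  refine ⟨fun x => fderiv ℝ f x (1, 0), fun x => fderiv ℝ f x (0, 1),
    fun x => fderiv ℝ (fderiv ℝ f) x (0, 1) (1, 0), by fun_prop, by fun_prop, by fun_prop,
    fun q t => (h1 _).hasDerivAt_fst, fun q t => (h1 _).hasDerivAt_snd,
    fun q t => (h2 _ _).hasDerivAt_snd, fun q t => ?_⟩
  dsimp only
  rw [(hsymm (q, t)).eq]
  exact (h2 (q, t) (0, 1)).hasDerivAt_fst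

/-- A function on the plane both of whose partial derivatives vanish is constant. -/
theorem eq_of_partial_derivs_eq_zero {f : ℝ → ℝ → ℝ} (hq : ∀ q t, HasDerivAt (fun s => f s t) 0 q)
    (ht : ∀ q t, HasDerivAt (fun s => f q s) 0 t) (q t q' t' : ℝ) : f q t = f q' t' :=
  (is_const_of_deriv_eq_zero (fun x => (hq x t).differentiableAt) (fun x => (hq x t).deriv)
    q q').trans
  (is_const_of_deriv_eq_zero (fun x => (ht q' x).differentiableAt) (fun x => (ht q' x).deriv)
    t t')

/-- (Elliptic case `n = 2`.)  Let `u₀ ∈ ℝ` and `u₁, u₂` smooth,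
`1`-periodic in `q`, with `(u₁)_t = 2u₀(u₁)_q − (u₂)_q`, `(u₂)_t = u₁(u₁)_q` and
`u₁ > u₀²` everywhere.  Then `u₁` and `u₂` are constant. -/
theorem elliptic_two_by_two_system_solutions_constant
    (u₀ : ℝ) (u₁ u₂ : ℝ → ℝ → ℝ)
    (h1 : ContDiff ℝ (⊤ : ℕ∞) (fun x : ℝ × ℝ => u₁ x.1 x.2))
    (h2 : ContDiff ℝ (⊤ : ℕ∞) (fun x : ℝ × ℝ => u₂ x.1 x.2))
    (hper1 : ∀ q t, u₁ (q + 1) t = u₁ q t)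
    (hper2 : ∀ q t, u₂ (q + 1) t = u₂ q t)
    (hpde1 : ∀ q t, deriv (fun t' => u₁ q t') t =
      2 * u₀ * deriv (fun q' => u₁ q' t) q - deriv (fun q' => u₂ q' t) q)
    (hpde2 : ∀ q t, deriv (fun t' => u₂ q t') t = u₁ q t * deriv (fun q' => u₁ q' t) q)
    (hell : ∀ q t, u₁ q t > u₀ ^ 2) :
    (∀ q t q' t', u₁ q t = u₁ q' t') ∧ (∀ q t q' t', u₂ q t = u₂ q' t') := by
  have hcu := h1.continuous
  obtain ⟨uq, ut, -, hcuq, hcut, -, huq, hut, -, -⟩ :=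
    (contDiff_infty.1 h1 2).exists_partial_derivs
  obtain ⟨vq, vt, vqt, hcvq, hcvt, hcvqt, hvq, hvt, hvqt, hvtq⟩ :=
    (contDiff_infty.1 h2 2).exists_partial_derivs
  dsimp only at huq hut hvq hvt
  have e1 : ∀ q t, ut (q, t) = 2 * u₀ * uq (q, t) - vq (q, t) := fun q t => by
    rw [← (hut q t).deriv, ← (huq q t).deriv, ← (hvq q t).deriv]; exact hpde1 q t
  have e2 : ∀ q t, vt (q, t) = u₁ q t * uq (q, t) := fun q t => by
    rw [← (hvt q t).deriv, ← (huq q t).deriv]; exact hpde2 q t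
  have hvtper : ∀ q t, vt (q + 1, t) = vt (q, t) := fun q t => by
    have h := hvt (q + 1) t
    simp only [hper2] at h
    exact h.unique (hvt q t)
  set E : ℝ × ℝ → ℝ := fun x => Real.exp (-u₁ x.1 x.2) with hE
  have hcE : Continuous E := by fun_prop
  have hEpos : ∀ x, 0 < E x := fun x => Real.exp_pos _
  have hEper : ∀ q t, E (q + 1, t) = E (q, t) := fun q t => by simp only [hE, hper1]
  have hEt : ∀ q t, HasDerivAt (fun s => E (q, s)) (E (q, t) * -ut (q, t)) t := fun q t =>
    (hut q t).neg.exp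
  have hEq : ∀ q t, HasDerivAt (fun s => E (s, t)) (E (q, t) * -uq (q, t)) q := fun q t =>
    (huq q t).neg.exp
  have hEle : ∀ x, E x ≤ Real.exp (-u₀ ^ 2) := fun x =>
    Real.exp_le_exp.2 (neg_le_neg (hell x.1 x.2).le)
  set K : ℝ × ℝ → ℝ := fun x =>
    E x * ((vq x - u₀ * uq x) ^ 2 + (u₁ x.1 x.2 - u₀ ^ 2) * uq x ^ 2) with hK
  have hcK : Continuous K := by fun_prop
  have hK0 : ∀ x, 0 ≤ K x := fun x => by
    have := sub_pos.2 (hell x.1 x.2)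
    have := hEpos x
    positivity
  have hF : ∀ c t, HasDerivAt (fun s => ∫ q in c..c + 1, E (q, s))
      (∫ q in c..c + 1, E (q, t) * vq (q, t)) t := fun c t => by
    have h := hasDerivAt_intervalIntegral_of_continuous_s11 (f' := fun x => E x * -ut x) hcE
      (by fun_prop) hEt c (c + 1) t
    have h0 := integral_deriv_eq_zero_of_periodic_s11
      (fun q => (hEq q t).const_mul (2 * u₀)) (by fun_prop) (fun q => by rw [hEper]) c
    have : ∀ q, E (q, t) * -ut (q, t) =
        2 * u₀ * (E (q, t) * -uq (q, t)) + E (q, t) * vq (q, t) := fun q => by rw [e1]; ring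
    simp only [this] at h
    rwa [intervalIntegral.integral_add
      ((by fun_prop : Continuous _).intervalIntegrable _ _)
      ((by fun_prop : Continuous _).intervalIntegrable _ _), h0, zero_add] at h
  have hG : ∀ c t, HasDerivAt (fun s => ∫ q in c..c + 1, E (q, s) * vq (q, s))
      (∫ q in c..c + 1, K (q, t)) t := fun c t => by
    have h := hasDerivAt_intervalIntegral_of_continuous_s11 (f := fun x => E x * vq x)
      (f' := fun x => E x * -ut x * vq x + E x * vqt x) (by fun_prop)
      (by fun_prop) (fun q t => (hEt q t).mul (hvqt q t)) c (c + 1) t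
    have h0 := integral_deriv_eq_zero_of_periodic_s11
      (fun q => (hEq q t).mul (hvtq q t)) (by fun_prop)
      (fun q => by simp only [Pi.mul_apply, hEper, hvtper]) c
    have : ∀ q, E (q, t) * -ut (q, t) * vq (q, t) + E (q, t) * vqt (q, t) =
        (E (q, t) * -uq (q, t) * vt (q, t) + E (q, t) * vqt (q, t)) + K (q, t) := fun q => by
      simp only [hK, e1, e2]; ring
    simp only [this] at h
    rwa [intervalIntegral.integral_add
      ((by fun_prop : Continuous _).intervalIntegrable _ _)
      ((by fun_prop : Continuous _).intervalIntegrable _ _), h0, zero_add] at h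
  have hGzero : ∀ c t, ∫ q in c..c + 1, E (q, t) * vq (q, t) = 0 := fun c =>
    eq_zero_of_hasDerivAt_of_monotone_of_bounded (M := Real.exp (-u₀ ^ 2)) (hF c)
      (monotone_of_hasDerivAt_nonneg (hG c) fun t =>
        intervalIntegral.integral_nonneg (by linarith) fun q _ => hK0 _)
      (fun t => intervalIntegral.integral_nonneg (by linarith) fun q _ => (hEpos _).le)
      (fun t => by
        have := intervalIntegral.integral_mono_on (μ := volume) (a := c) (b := c + 1) (by linarith)
          ((by fun_prop : Continuous fun q => E (q, t)).intervalIntegrable _ _)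
          intervalIntegrable_const fun q _ => hEle (q, t)
        simpa using this)
  have hKzero : ∀ q t, K (q, t) = 0 := fun c t => by
    have hint : ∫ q in c..c + 1, K (q, t) = 0 := by
      have h := hG c t
      simp only [hGzero] at h
      exact h.unique (hasDerivAt_const t 0)
    by_contra hne
    have := intervalIntegral.integral_pos (by linarith : c < c + 1)
      (by fun_prop : Continuous fun q => K (q, t)).continuousOn (fun q _ => hK0 _)
      ⟨c, ⟨le_rfl, by linarith⟩, lt_of_le_of_ne (hK0 _) (Ne.symm hne)⟩
    exact this.ne' hint
  have huq0 : ∀ q t, uq (q, t) = 0 := fun q t => by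
    have h := (mul_eq_zero.1 (hKzero q t)).resolve_left (hEpos _).ne'
    have hpos := sub_pos.2 (hell q t)
    by_contra hne
    have : 0 < (u₁ q t - u₀ ^ 2) * uq (q, t) ^ 2 := by positivity
    dsimp only at h
    linarith [sq_nonneg (vq (q, t) - u₀ * uq (q, t))]
  have hvq0 : ∀ q t, vq (q, t) = 0 := fun q t => by
    have h := (mul_eq_zero.1 (hKzero q t)).resolve_left (hEpos _).ne'
    simpa [huq0] using h
  simp only [e1, e2, huq0, hvq0, mul_zero, sub_zero] at huq hut hvq hvt
  exact ⟨eq_of_partial_derivs_eq_zero huq hut, eq_of_partial_derivs_eq_zero hvq hvt⟩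
end
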